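/- Let k ≥ 3 and let d_1, …, d_{k−1} be positive integers satisfying d_1 − d_2 ≥ 2, d_{i−1} − d_i ≥ i − 1 for 3 ≤ i ≤ k − 1, and d_{k−1} ≥ k − 1. Set n = Σ_{i=1}^{k−1}(2^{d_i} − 1). Then dim_{F_2}(QP_k)_n = Π_{i=1}^{k}(2^i − 1). -/

import Mathlib

open MvPolynomial

/-- The total Steenrod square on `P_k = F_2[x_1,…,x_k]`, the algebra map with
`Sq(x_j) = x_j + x_j^2`. -/
noncomputable def SqTotal (k : ℕ) :
    MvPolynomial (Fin k) (ZMod 2) →ₐ[ZMod 2] MvPolynomial (Fin k) (ZMod 2) :=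
  aeval fun j => X j + X j ^ 2

/-- The Steenrod square `Sq^i : P_k → P_k`, sending a homogeneous polynomial `f` of
degree `d` to the degree-`d + i` homogeneous component of `Sq(f)`, extended additively. -/
noncomputable def SqOp (k i : ℕ) (f : MvPolynomial (Fin k) (ZMod 2)) :
    MvPolynomial (Fin k) (ZMod 2) :=
  ∑ d ∈ Finset.range (f.totalDegree + 1),
    homogeneousComponent (d + i) (SqTotal k (homogeneousComponent d f))

/-- The space of hit polynomials: finite sums of `Sq^i (f_i)` with `i > 0`. -/
noncomputable def hitSubmodule (k : ℕ) :
    Submodule (ZMod 2) (MvPolynomial (Fin k) (ZMod 2)) :=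
  Submodule.span (ZMod 2) {g | ∃ i f, 0 < i ∧ g = SqOp k i f}

/-- A polynomial is hit if it is a finite sum of `Sq^i (f_i)` with `i > 0`. -/
def IsHit (k : ℕ) (f : MvPolynomial (Fin k) (ZMod 2)) : Prop := f ∈ hitSubmodule k

/-- `(QP_k)_n`: the space of homogeneous polynomials of degree `n` modulo hit polynomials. -/
abbrev QP (k n : ℕ) :=
  ↥(homogeneousSubmodule (Fin k) (ZMod 2) n) ⧸
    ((hitSubmodule k).comap (homogeneousSubmodule (Fin k) (ZMod 2) n).subtype)

section Steenrod

variable {σ τ : Type*}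

local notation "𝔓" σ => MvPolynomial σ (ZMod 2)

/-- The graded total square `x ↦ x + t x²`, whose coefficient at `t ^ i` is `Sq^i`. -/
noncomputable def sqPoly (σ : Type*) :
    MvPolynomial σ (ZMod 2) →ₐ[ZMod 2] Polynomial (MvPolynomial σ (ZMod 2)) :=
  aeval fun j => Polynomial.C (X j) + Polynomial.X * Polynomial.C (X j ^ 2)

/-- The Steenrod square `Sq^i` as a linear map. -/
noncomputable def stSq (σ : Type*) (i : ℕ) :
    MvPolynomial σ (ZMod 2) →ₗ[ZMod 2] MvPolynomial σ (ZMod 2) :=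
  ((Polynomial.lcoeff (MvPolynomial σ (ZMod 2)) i).restrictScalars (ZMod 2)) ∘ₗ
    (sqPoly σ).toLinearMap

lemma stSq_apply (i : ℕ) (f : 𝔓 σ) : stSq σ i f = (sqPoly σ f).coeff i := rfl

lemma sqPoly_X (j : σ) : sqPoly σ (X j) =
    Polynomial.C (X j) + Polynomial.X * Polynomial.C (X j ^ 2) := by
  simp [sqPoly]

lemma stSq_mul (n : ℕ) (f g : 𝔓 σ) :
    stSq σ n (f * g) = ∑ p ∈ Finset.HasAntidiagonal.antidiagonal n, stSq σ p.1 f * stSq σ p.2 g := by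
  simp only [stSq_apply, map_mul, Polynomial.coeff_mul]

lemma stSq_pow_two (n : ℕ) (g : 𝔓 σ) : stSq σ (2 * n) (g ^ 2) = stSq σ n g ^ 2 := by
  rw [stSq_apply, map_pow, ← Polynomial.map_frobenius_expand 2 (sqPoly σ g),
    Polynomial.coeff_map, mul_comm, Polynomial.coeff_expand_mul (by norm_num)]
  rfl

lemma stSq_pow_two_of_odd {n : ℕ} (hn : Odd n) (g : 𝔓 σ) : stSq σ n (g ^ 2) = 0 := by
  rw [stSq_apply, map_pow, ← Polynomial.map_frobenius_expand 2 (sqPoly σ g),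
    Polynomial.coeff_map, Polynomial.coeff_expand (by norm_num), if_neg, map_zero]
  rwa [← even_iff_two_dvd, Nat.not_even_iff_odd]

lemma stSq_X (i : ℕ) (j : σ) :
    stSq σ i (X j) = if i = 0 then X j else if i = 1 then X j ^ 2 else 0 := by
  rw [stSq_apply, sqPoly_X]
  rcases i with _ | _ | i
  · simp
  · simp [-map_pow, Polynomial.coeff_C]
  · rw [Polynomial.coeff_add, Polynomial.coeff_X_mul]; simp [-map_pow]

lemma stSq_C (i : ℕ) (a : ZMod 2) : stSq σ i (C a) = if i = 0 then C a else 0 := by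
  rw [stSq_apply, ← MvPolynomial.algebraMap_eq, AlgHom.commutes, Polynomial.algebraMap_apply,
    Polynomial.coeff_C]

lemma stSq_one_eq_zero {i : ℕ} (hi : 0 < i) : stSq σ i 1 = 0 := by
  rw [stSq_apply, map_one, Polynomial.coeff_one, if_neg hi.ne']

lemma stSq_zero (f : 𝔓 σ) : stSq σ 0 f = f := by
  induction f using MvPolynomial.induction_on with
  | C a =>
    rw [stSq_apply, ← MvPolynomial.algebraMap_eq, AlgHom.commutes, Polynomial.algebraMap_apply,
      Polynomial.coeff_C_zero]
  | add p q hp hq => rw [map_add, hp, hq]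
  | mul_X p j hp => simp [stSq_mul, hp, stSq_X]

lemma stSq_succ_X_mul (i : ℕ) (j : σ) (f : 𝔓 σ) :
    stSq σ (i + 1) (X j * f) = X j * stSq σ (i + 1) f + X j ^ 2 * stSq σ i f := by
  rw [stSq_mul, Finset.Nat.sum_antidiagonal_succ, stSq_X]
  rcases i with _ | i
  · simp [stSq_X]
  · rw [Finset.Nat.sum_antidiagonal_succ]
    simp [stSq_X]

lemma stSq_one_mul (f g : 𝔓 σ) : stSq σ 1 (f * g) = f * stSq σ 1 g + stSq σ 1 f * g := by
  simp [stSq_mul, Finset.Nat.antidiagonal_succ, stSq_zero]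


lemma Finsupp.induction_add_single_one {p : (σ →₀ ℕ) → Prop} (zero : p 0)
    (add_single : ∀ e j, p e → p (e + Finsupp.single j 1)) (e : σ →₀ ℕ) : p e := by
  induction hn : e.degree using Nat.strong_induction_on generalizing e with
  | _ n ih =>
    by_cases he : e = 0
    · rwa [he]
    · obtain ⟨j, hj⟩ := Finsupp.ne_iff.1 he
      have hle : Finsupp.single j 1 ≤ e := by
        simpa [Finsupp.single_le_iff, Nat.one_le_iff_ne_zero] using hj
      have hdeg := congrArg Finsupp.degree (tsub_add_cancel_of_le hle)
      rw [map_add, Finsupp.degree_single] at hdeg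
      rw [← tsub_add_cancel_of_le hle]
      exact add_single _ _ (ih _ (by omega) _ rfl)

lemma monomial_add_single_one (e : σ →₀ ℕ) (j : σ) :
    (monomial (e + Finsupp.single j 1) 1 : 𝔓 σ) = X j * monomial e 1 := by
  rw [X, monomial_mul, one_mul, add_comm]

lemma monomial_mem_of_ne_zero {c : ZMod 2} (e : σ →₀ ℕ) (p : Submodule (ZMod 2) (𝔓 σ))
    (h : monomial e 1 ∈ p) : monomial e c ∈ p := by
  simpa [smul_monomial] using p.smul_mem c h

lemma MvPolynomial.mem_of_support (p : Submodule (ZMod 2) (𝔓 σ)) (f : 𝔓 σ)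
    (h : ∀ e ∈ f.support, monomial e 1 ∈ p) : f ∈ p := by
  rw [f.as_sum]
  exact p.sum_mem fun e he => monomial_mem_of_ne_zero e p (h e he)

lemma stSq_monomial_isHomogeneous (e : σ →₀ ℕ) (i : ℕ) :
    (stSq σ i (monomial e 1)).IsHomogeneous (e.degree + i) := by
  induction e using Finsupp.induction_add_single_one generalizing i with
  | zero =>
    rw [← C_apply, map_one]
    rcases i with _ | i
    · simpa [stSq_zero] using isHomogeneous_one σ (ZMod 2)
    · rw [stSq_one_eq_zero i.succ_pos]
      exact isHomogeneous_zero _ _ _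
  | add_single e j ih =>
    rw [monomial_add_single_one, map_add, Finsupp.degree_single]
    rcases i with _ | i
    · rw [stSq_zero, ← monomial_add_single_one]
      exact isHomogeneous_monomial _ (by simp)
    · rw [stSq_succ_X_mul]
      refine IsHomogeneous.add ?_ ?_
      · have := (isHomogeneous_X (ZMod 2) j).mul (ih (i + 1))
        rwa [show 1 + (e.degree + (i + 1)) = e.degree + 1 + (i + 1) by ring] at this
      · have := ((isHomogeneous_X (ZMod 2) j).pow 2).mul (ih i)
        rwa [show 1 * 2 + (e.degree + i) = e.degree + 1 + (i + 1) by ring] at this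

lemma stSq_isHomogeneous {f : 𝔓 σ} {d : ℕ} (hf : f.IsHomogeneous d) (i : ℕ) :
    (stSq σ i f).IsHomogeneous (d + i) := by
  have : f ∈ (homogeneousSubmodule σ (ZMod 2) (d + i)).comap (stSq σ i) := by
    refine MvPolynomial.mem_of_support _ _ fun e he => ?_
    have := stSq_monomial_isHomogeneous e i
    rwa [hf.degree_eq_sum_deg_support he]
  exact this

lemma stSq_monomial_of_degree_lt {e : σ →₀ ℕ} {i : ℕ} (h : e.degree < i) :
    stSq σ i (monomial e 1) = 0 := by
  induction e using Finsupp.induction_add_single_one generalizing i with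
  | zero => rw [← C_apply, map_one, stSq_one_eq_zero (by omega)]
  | add_single e j ih =>
    rw [map_add, Finsupp.degree_single] at h
    obtain ⟨i, rfl⟩ := Nat.exists_eq_succ_of_ne_zero (by omega : i ≠ 0)
    rw [monomial_add_single_one, stSq_succ_X_mul, ih (by omega), ih (by omega)]
    simp

lemma stSq_degree_monomial (e : σ →₀ ℕ) :
    stSq σ e.degree (monomial e 1) = monomial e 1 ^ 2 := by
  induction e using Finsupp.induction_add_single_one with
  | zero => simp [stSq_zero]
  | add_single e j ih =>
    rw [map_add, Finsupp.degree_single, monomial_add_single_one, stSq_succ_X_mul, ih,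
      stSq_monomial_of_degree_lt (by omega)]
    ring

/-- A substitution by linear forms commutes with the Steenrod squares. -/
lemma stSq_map_comm (L : (𝔓 σ) →ₐ[ZMod 2] 𝔓 τ)
    (hL : ∀ j, stSq τ 1 (L (X j)) = L (X j) ^ 2 ∧ ∀ i, stSq τ (i + 2) (L (X j)) = 0)
    (i : ℕ) (f : 𝔓 σ) : stSq τ i (L f) = L (stSq σ i f) := by
  induction f using MvPolynomial.induction_on generalizing i with
  | C a =>
    rw [← MvPolynomial.algebraMap_eq, AlgHom.commutes, MvPolynomial.algebraMap_eq, stSq_C,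
      MvPolynomial.algebraMap_eq, stSq_C]
    split_ifs <;> simp [← MvPolynomial.algebraMap_eq]
  | add p q hp hq => simp only [map_add, hp, hq]
  | mul_X p j hp =>
    rw [map_mul, stSq_mul, stSq_mul, map_sum]
    refine Finset.sum_congr rfl fun x _ => ?_
    rw [map_mul, hp]
    congr 1
    rcases x.2 with _ | _ | i
    · simp [stSq_zero]
    · simp [hL, stSq_X]
    · simp [hL, stSq_X]

lemma stSq_sum_X (s : Finset σ) : stSq σ 1 (∑ j ∈ s, X j) = (∑ j ∈ s, X j) ^ 2 ∧
    ∀ i, stSq σ (i + 2) (∑ j ∈ s, X j) = 0 := by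
  constructor
  · simp [stSq_X, sum_pow_char]
  · simp [stSq_X]

lemma stSq_X_pow_two_pow_mul (b j : ℕ) (x : σ) (g : 𝔓 σ) :
    stSq σ b (X x ^ 2 ^ j * g) = X x ^ 2 ^ j * stSq σ b g +
      if 2 ^ j ≤ b then X x ^ 2 ^ (j + 1) * stSq σ (b - 2 ^ j) g else 0 := by
  have : sqPoly σ (X x ^ 2 ^ j) = Polynomial.C (X x ^ 2 ^ j) +
      Polynomial.X ^ 2 ^ j * Polynomial.C (X x ^ 2 ^ (j + 1)) := by
    rw [map_pow, sqPoly_X, add_pow_char_pow, mul_pow, ← map_pow, ← map_pow, ← pow_mul,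
      ← pow_succ']
  rw [stSq_apply, map_mul, this, add_mul, Polynomial.coeff_add, Polynomial.coeff_C_mul, mul_assoc,
    Polynomial.coeff_X_pow_mul', Polynomial.coeff_C_mul]
  rfl

lemma mul_X_pow_mul_stSq_mem (K : Submodule (ZMod 2) (𝔓 σ)) (f g : 𝔓 σ) (x : σ) (a : ℕ)
    (h : ∀ b j, b + 2 ^ j = a + 1 → f * stSq σ b (X x ^ 2 ^ j * g) ∈ K) (b j : ℕ)
    (hb : b + 2 ^ j = a + 1) : f * (X x ^ 2 ^ j * stSq σ b g) ∈ K := by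
  induction b using Nat.strong_induction_on generalizing j with
  | _ b ih =>
    have h1 := h b j hb
    rw [stSq_X_pow_two_pow_mul, mul_add] at h1
    refine (Submodule.add_mem_iff_left _ ?_).1 h1
    split_ifs with hj
    · have := Nat.two_pow_pos j
      exact ih (b - 2 ^ j) (by omega) (j + 1) (by rw [pow_succ]; omega)
    · simp

/-- The `χ`-trick: modulo hit elements, `Sq^a` moves from `g` to the product of variables. -/
lemma prod_X_mul_stSq_mem [DecidableEq σ] (K : Submodule (ZMod 2) (𝔓 σ))
    (hK : ∀ i f, 0 < i → stSq σ i f ∈ K) (s : Finset σ) (a : ℕ) (g : 𝔓 σ)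
    (h : ∀ j : σ → ℕ, ∑ x ∈ s, (2 ^ j x - 1) = a → (∏ x ∈ s, X x ^ 2 ^ j x) * g ∈ K) :
    (∏ x ∈ s, X x) * stSq σ a g ∈ K := by
  induction s using Finset.induction_on generalizing a g with
  | empty =>
    rcases a with _ | a
    · simpa [stSq_zero] using h 0
    · simpa using hK (a + 1) g a.succ_pos
  | insert x s hx ih =>
    have key := mul_X_pow_mul_stSq_mem K (∏ x ∈ s, X x) g x a (fun b i hb => ?_) a 0 rfl
    · rw [Finset.prod_insert hx, mul_comm (X x), mul_assoc]
      simpa using key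
    · refine ih _ _ fun j hj => ?_
      have hu : ∀ y ∈ s, Function.update j x i y = j y := fun y hy =>
        Function.update_of_ne (by rintro rfl; exact hx hy) _ _
      have := h (Function.update j x i) ?_
      · rw [Finset.prod_insert hx, Function.update_self,
          Finset.prod_congr rfl fun y hy => by rw [hu y hy]] at this
        convert this using 1
        ring
      · rw [Finset.sum_insert hx, Function.update_self,
          Finset.sum_congr rfl fun y hy => by rw [hu y hy], hj]
        have := Nat.two_pow_pos i
        omega

end Steenrod

section Cohit

variable {σ τ : Type*}

local notation "𝔓" σ => MvPolynomial σ (ZMod 2)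

lemma eval_one_sqPoly (k : ℕ) (f : 𝔓 (Fin k)) : (sqPoly (Fin k) f).eval 1 = SqTotal k f := by
  induction f using MvPolynomial.induction_on with
  | C a => rw [← MvPolynomial.algebraMap_eq, AlgHom.commutes, AlgHom.commutes,
      Polynomial.algebraMap_apply, Polynomial.eval_C]
  | add p q hp hq => simp only [map_add, Polynomial.eval_add, hp, hq]
  | mul_X p j hp =>
    rw [map_mul, map_mul, Polynomial.eval_mul, hp, sqPoly_X]
    simp [SqTotal]

lemma homogeneousComponent_SqTotal {k d : ℕ} {f : 𝔓 (Fin k)} (hf : f.IsHomogeneous d) (i : ℕ) :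
    homogeneousComponent (d + i) (SqTotal k f) = stSq (Fin k) i f := by
  rw [← eval_one_sqPoly, Polynomial.eval_eq_sum_range' (n := (sqPoly _ f).natDegree + i + 1)
    (by omega), map_sum, Finset.sum_eq_single i]
  · rw [one_pow, mul_one, ← stSq_apply]
    exact homogeneousComponent_eq_self (stSq_isHomogeneous hf i)
  · intro j _ hj
    rw [one_pow, mul_one, ← stSq_apply, homogeneousComponent_of_mem (stSq_isHomogeneous hf j),
      if_neg (by omega)]
  · intro h
    exact absurd (Finset.mem_range.2 (by omega)) h

lemma SqOp_eq_stSq (k i : ℕ) (f : 𝔓 (Fin k)) : SqOp k i f = stSq (Fin k) i f := by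
  conv_rhs => rw [← sum_homogeneousComponent f, map_sum]
  exact Finset.sum_congr rfl fun d _ =>
    homogeneousComponent_SqTotal (homogeneousComponent_isHomogeneous d f) i

lemma homogeneousComponent_monomial_one (n : ℕ) (e : σ →₀ ℕ) :
    homogeneousComponent n (monomial e 1 : 𝔓 σ) = if e.degree = n then monomial e 1 else 0 := by
  rw [homogeneousComponent_of_mem (isHomogeneous_monomial 1 rfl)]
  simp only [eq_comm]

/-- The polynomials whose component of degree `n` is hit. -/
noncomputable def cohitKer (σ : Type*) (n : ℕ) : Submodule (ZMod 2) (MvPolynomial σ (ZMod 2)) :=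
  Submodule.span (ZMod 2) {g | (∃ i f, 0 < i ∧ g = stSq σ i f) ∨
    ∃ e : σ →₀ ℕ, e.degree ≠ n ∧ g = monomial e 1}

lemma stSq_mem_cohitKer (n : ℕ) {i : ℕ} (hi : 0 < i) (f : 𝔓 σ) : stSq σ i f ∈ cohitKer σ n :=
  Submodule.subset_span (Or.inl ⟨i, f, hi, rfl⟩)

lemma monomial_mem_cohitKer {n : ℕ} {e : σ →₀ ℕ} (he : e.degree ≠ n) :
    monomial e 1 ∈ cohitKer σ n :=
  Submodule.subset_span (Or.inr ⟨e, he, rfl⟩)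

lemma mem_cohitKer_of_isHomogeneous {n d : ℕ} {f : 𝔓 σ} (hf : f.IsHomogeneous d) (hd : d ≠ n) :
    f ∈ cohitKer σ n :=
  MvPolynomial.mem_of_support _ _ fun e he =>
    monomial_mem_cohitKer (by rwa [show e.degree = d from (hf.degree_eq_sum_deg_support he).symm])

/-- `cohitKer` is contained in a submodule as soon as its monomial generators are. -/
lemma cohitKer_le {n : ℕ} {p : Submodule (ZMod 2) (𝔓 σ)}
    (h1 : ∀ i e, 0 < i → stSq σ i (monomial e 1) ∈ p)
    (h2 : ∀ e : σ →₀ ℕ, e.degree ≠ n → monomial e 1 ∈ p) : cohitKer σ n ≤ p := by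
  refine Submodule.span_le.2 ?_
  rintro g (⟨i, f, hi, rfl⟩ | ⟨e, he, rfl⟩)
  · exact MvPolynomial.mem_of_support (p.comap (stSq σ i)) f fun e _ => h1 i e hi
  · exact h2 e he

lemma homogeneousComponent_mem_hitSubmodule {k n : ℕ} {f : 𝔓 (Fin k)}
    (hf : f ∈ cohitKer (Fin k) n) : homogeneousComponent n f ∈ hitSubmodule k := by
  refine cohitKer_le (p := (hitSubmodule k).comap (homogeneousComponent n)) ?_ ?_ hf
  · intro i e hi
    rw [Submodule.mem_comap, homogeneousComponent_of_mem (stSq_monomial_isHomogeneous e i)]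
    split_ifs
    · exact Submodule.subset_span ⟨i, _, hi, (SqOp_eq_stSq k i _).symm⟩
    · exact Submodule.zero_mem _
  · intro e he
    rw [Submodule.mem_comap, homogeneousComponent_monomial_one, if_neg he]
    exact Submodule.zero_mem _

lemma hitSubmodule_le_cohitKer (k n : ℕ) : hitSubmodule k ≤ cohitKer (Fin k) n := by
  refine Submodule.span_le.2 ?_
  rintro g ⟨i, f, hi, rfl⟩
  rw [SqOp_eq_stSq]
  exact stSq_mem_cohitKer n hi f

lemma finrank_QP (k n : ℕ) :
    Module.finrank (ZMod 2) (QP k n) =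
      Module.finrank (ZMod 2) ((𝔓 (Fin k)) ⧸ cohitKer (Fin k) n) := by
  refine LinearEquiv.finrank_eq (LinearEquiv.ofBijective (Submodule.mapQ _ _
    (homogeneousSubmodule (Fin k) (ZMod 2) n).subtype
    (Submodule.comap_mono (hitSubmodule_le_cohitKer k n))) ⟨?_, ?_⟩)
  · rw [← LinearMap.ker_eq_bot, Submodule.ker_mapQ, eq_bot_iff, Submodule.map_le_iff_le_comap,
      Submodule.comap_bot, Submodule.ker_mkQ]
    rintro ⟨f, hf⟩ h
    have := homogeneousComponent_mem_hitSubmodule (n := n) h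
    rwa [Submodule.subtype_apply, homogeneousComponent_eq_self hf] at this
  · intro v
    obtain ⟨f, rfl⟩ := Submodule.mkQ_surjective _ v
    refine ⟨Submodule.Quotient.mk ⟨homogeneousComponent n f,
      homogeneousComponent_isHomogeneous n f⟩, ?_⟩
    rw [Submodule.mapQ_apply, Submodule.mkQ_apply, Submodule.Quotient.eq]
    have : f ∈ (cohitKer (Fin k) n).comap
        (homogeneousComponent n - LinearMap.id : (𝔓 (Fin k)) →ₗ[ZMod 2] 𝔓 (Fin k)) := by
      refine MvPolynomial.mem_of_support _ _ fun e _ => ?_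
      rw [Submodule.mem_comap, LinearMap.sub_apply, homogeneousComponent_monomial_one]
      split_ifs with h
      · simp
      · simpa using monomial_mem_cohitKer h
    exact this

lemma finrank_QP_zero (k : ℕ) : Module.finrank (ZMod 2) (QP k 0) = 1 := by
  rw [finrank_QP]
  have hs : Function.Surjective (lcoeff (ZMod 2) (0 : Fin k →₀ ℕ)) :=
    fun c => ⟨C c, by simp⟩
  have hker : cohitKer (Fin k) 0 = LinearMap.ker (lcoeff (ZMod 2) (0 : Fin k →₀ ℕ)) := by
    refine le_antisymm (cohitKer_le (fun i e hi => ?_) fun e he => ?_) fun f hf => ?_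
    · rw [LinearMap.mem_ker, lcoeff_apply]
      exact (stSq_monomial_isHomogeneous e i).coeff_eq_zero (by simp; omega)
    · rw [LinearMap.mem_ker, lcoeff_apply, coeff_monomial, if_neg]
      rintro rfl
      simp at he
    · refine MvPolynomial.mem_of_support _ _ fun e he => monomial_mem_cohitKer fun h => ?_
      rw [(Finsupp.degree_eq_zero_iff e).1 h] at he
      exact mem_support_iff.1 he hf
  rw [hker, ((lcoeff (ZMod 2) (0 : Fin k →₀ ℕ)).quotKerEquivOfSurjective hs).finrank_eq,
    Module.finrank_self]

/-- Substitutions by linear forms preserve hit polynomials. -/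
lemma map_mem_cohitKer {n : ℕ} (L : (𝔓 σ) →ₐ[ZMod 2] 𝔓 τ)
    (s : σ → Finset τ) (hL : ∀ j, L (X j) = ∑ t ∈ s j, X t) {f : 𝔓 σ} (hf : f ∈ cohitKer σ n) :
    L f ∈ cohitKer τ n := by
  refine cohitKer_le (p := (cohitKer τ n).comap L.toLinearMap) ?_ ?_ hf
  · intro i e hi
    rw [Submodule.mem_comap, AlgHom.toLinearMap_apply,
      ← stSq_map_comm L (fun j => by rw [hL]; exact stSq_sum_X _)]
    exact stSq_mem_cohitKer n hi _
  · intro e he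
    refine mem_cohitKer_of_isHomogeneous (d := e.degree) ?_ he
    rw [AlgHom.toLinearMap_apply, aeval_unique L]
    have := (isHomogeneous_monomial (1 : ZMod 2) (rfl : e.degree = e.degree)).aeval (n := 1)
      (fun j => L (X j)) fun j => by
        rw [hL]; exact IsHomogeneous.sum _ _ _ fun t _ => isHomogeneous_X _ t
    rwa [one_mul] at this

end Cohit

section Kameko

variable {σ : Type*}

local notation "𝔓" σ => MvPolynomial σ (ZMod 2)

/-- The linear map `y ↦ p * y ^ 2`. -/
noncomputable def mulSq (p : 𝔓 σ) : (𝔓 σ) →ₗ[ZMod 2] 𝔓 σ :=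
  LinearMap.mulLeft (ZMod 2) p ∘ₗ
    AddMonoidHom.toZModLinearMap 2 (frobenius (𝔓 σ) 2).toAddMonoidHom

lemma mulSq_apply (p y : 𝔓 σ) : mulSq p y = p * y ^ 2 := rfl

/-- In degree `n`, monomials with two even exponents are hit. -/
def IsLow (σ : Type*) (n : ℕ) : Prop :=
  ∀ (e : σ →₀ ℕ) (a b : σ), a ≠ b → Even (e a) → Even (e b) →
    (monomial e 1 : MvPolynomial σ (ZMod 2)) ∈ cohitKer σ n

lemma prod_X_eq_monomial (s : Finset σ) :
    (∏ x ∈ s, X x : 𝔓 σ) = monomial (∑ x ∈ s, Finsupp.single x 1) 1 := by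
  rw [monomial_sum_one]
  rfl

lemma IsLow.prod_mul_sq_mem {n : ℕ} (h : IsLow σ n) (s : Finset σ) {a b : σ} (hab : a ≠ b)
    (ha : a ∉ s) (hb : b ∉ s) (y : 𝔓 σ) : (∏ x ∈ s, X x) * y ^ 2 ∈ cohitKer σ n := by
  classical
  have key : y ∈ (cohitKer σ n).comap (mulSq (∏ x ∈ s, X x)) := by
    refine MvPolynomial.mem_of_support _ _ fun e _ => ?_
    rw [Submodule.mem_comap, mulSq_apply, prod_X_eq_monomial, monomial_pow, monomial_mul,
      one_pow, mul_one]
    have hz : ∀ c ∉ s, Even ((∑ x ∈ s, Finsupp.single x 1 + 2 • e : σ →₀ ℕ) c) := fun c hc => by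
      rw [Finsupp.add_apply, Finsupp.finsetSum_apply, Finset.sum_eq_zero]
      · simp
      · rintro x hx
        exact Finsupp.single_eq_of_ne (by rintro rfl; exact hc hx)
    exact h _ a b hab (hz a ha) (hz b hb)
  exact key

lemma isHomogeneous_prod_X (s : Finset σ) : (∏ x ∈ s, X x : 𝔓 σ).IsHomogeneous s.card := by
  simpa using IsHomogeneous.prod s (fun x => (X x : 𝔓 σ)) (fun _ => 1)
    fun x _ => isHomogeneous_X _ x

lemma stSq_one_prod_X [DecidableEq σ] (s : Finset σ) :
    stSq σ 1 (∏ x ∈ s, X x) = ∑ c ∈ s, (∏ x ∈ s.erase c, X x) * X c ^ 2 := by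
  induction s using Finset.induction_on with
  | empty => simp [stSq_one_eq_zero]
  | insert a s ha ih =>
    rw [Finset.prod_insert ha, stSq_one_mul, ih, Finset.sum_insert ha, Finset.erase_insert ha,
      stSq_X, add_comm, Finset.mul_sum]
    congr 1
    · simp [mul_comm]
    · refine Finset.sum_congr rfl fun c hc => ?_
      rw [Finset.erase_insert_of_ne (by rintro rfl; exact ha hc), Finset.prod_insert (by simp [ha]),
        mul_assoc]

variable [Fintype σ] [DecidableEq σ]

/-- The product of all variables but `X a`. -/
noncomputable def prodErase (a : σ) : 𝔓 σ := ∏ x ∈ Finset.univ.erase a, X x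

lemma X_mul_prodErase (a : σ) : X a * prodErase a = (∏ x, X x : 𝔓 σ) :=
  Finset.mul_prod_erase _ _ (Finset.mem_univ a)

lemma sum_prodErase_mul_sq_mem (n : ℕ) (g : 𝔓 σ) :
    ∑ c, prodErase c * (X c * g) ^ 2 ∈ cohitKer σ n := by
  have h := stSq_mem_cohitKer n one_pos ((∏ x, X x) * g ^ 2)
  rw [stSq_one_mul, stSq_pow_two_of_odd odd_one, mul_zero, zero_add, stSq_one_prod_X,
    Finset.sum_mul] at h
  convert h using 2
  rw [mul_pow, mul_assoc]
  rfl

/-- The Kameko-type maps `y ↦ prodErase a * y ^ 2` preserve hit polynomials. -/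
lemma mulSq_prodErase_mem {c n : ℕ} (hc : Fintype.card σ = c + 1) (h : IsLow σ (c + 2 * n))
    (a : σ) {y : 𝔓 σ} (hy : y ∈ cohitKer σ n) :
    mulSq (prodErase a) y ∈ cohitKer σ (c + 2 * n) := by
  refine cohitKer_le (p := (cohitKer σ _).comap (mulSq (prodErase a))) ?_ ?_ hy
  · intro i e hi
    rw [Submodule.mem_comap, mulSq_apply, ← stSq_pow_two]
    refine prod_X_mul_stSq_mem _ (fun i f hi => stSq_mem_cohitKer _ hi f) _ _ _ fun j hj => ?_
    obtain ⟨s, hs, hjs⟩ : ∃ s ∈ Finset.univ.erase a, 0 < j s := by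
      by_contra! hcon
      rw [Finset.sum_eq_zero fun x hx => by simp [Nat.le_zero.1 (hcon x hx)]] at hj
      omega
    rw [← Finset.prod_filter_mul_prod_filter_not (Finset.univ.erase a) (fun x => j x = 0)]
    have h1 : ∏ x ∈ (Finset.univ.erase a).filter (fun x => j x = 0), (X x : 𝔓 σ) ^ 2 ^ j x =
        ∏ x ∈ (Finset.univ.erase a).filter (fun x => j x = 0), X x :=
      Finset.prod_congr rfl fun x hx => by simp [(Finset.mem_filter.1 hx).2]
    have h2 : ∏ x ∈ (Finset.univ.erase a).filter (fun x => ¬ j x = 0), (X x : 𝔓 σ) ^ 2 ^ j x =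
        (∏ x ∈ (Finset.univ.erase a).filter (fun x => ¬ j x = 0), X x ^ 2 ^ (j x - 1)) ^ 2 := by
      rw [← Finset.prod_pow]
      refine Finset.prod_congr rfl fun x hx => ?_
      have := (Finset.mem_filter.1 hx).2
      rw [← pow_mul, ← pow_succ, show j x - 1 + 1 = j x by omega]
    rw [h1, h2, mul_assoc, ← mul_pow]
    exact h.prod_mul_sq_mem _ (Finset.ne_of_mem_erase hs) (by simp [hjs.ne']) (by simp) _
  · intro e he
    refine mem_cohitKer_of_isHomogeneous ((isHomogeneous_prod_X _).mul
      ((isHomogeneous_monomial 1 rfl).pow 2)) ?_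
    rw [Finset.card_erase_of_mem (Finset.mem_univ a), Finset.card_univ, hc]
    omega

/-- The iterated Kameko-type map along a list of variables. -/
noncomputable def kameko : List σ → (𝔓 σ) →ₗ[ZMod 2] 𝔓 σ
  | [] => LinearMap.id
  | a :: l => mulSq (prodErase a) ∘ₗ kameko l

lemma kameko_cons (a : σ) (l : List σ) (y : 𝔓 σ) :
    kameko (a :: l) y = prodErase a * kameko l y ^ 2 := rfl

/-- The degrees `n ↦ c + 2 n` iterated. -/
def lev (c m : ℕ) : ℕ → ℕ
  | 0 => m
  | j + 1 => c + 2 * lev c m j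

variable {c m : ℕ}

lemma kameko_mem (hc : Fintype.card σ = c + 1) (hL : ∀ j, IsLow σ (lev c m (j + 1)))
    (l : List σ) {y : 𝔓 σ} (hy : y ∈ cohitKer σ m) :
    kameko l y ∈ cohitKer σ (lev c m l.length) := by
  induction l with
  | nil => exact hy
  | cons a l ih => exact mulSq_prodErase_mem hc (hL _) a ih

/-- Two lists define the same iterated Kameko map modulo hit polynomials. -/
def KamekoEquiv (c m : ℕ) (l l' : List σ) : Prop :=
  l.length = l'.length ∧ ∀ y, kameko l y - kameko l' y ∈ cohitKer σ (lev c m l.length)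

lemma KamekoEquiv.refl (l : List σ) : KamekoEquiv c m l l := ⟨rfl, by simp⟩

lemma KamekoEquiv.trans {l l' l'' : List σ} (h : KamekoEquiv c m l l')
    (h' : KamekoEquiv c m l' l'') : KamekoEquiv c m l l'' :=
  ⟨h.1.trans h'.1, fun y => by
    have := Submodule.add_mem _ (h.2 y) (h.1 ▸ h'.2 y)
    rwa [sub_add_sub_cancel] at this⟩

lemma KamekoEquiv.cons (hc : Fintype.card σ = c + 1) (hL : ∀ j, IsLow σ (lev c m (j + 1)))
    (a : σ) {l l' : List σ} (h : KamekoEquiv c m l l') : KamekoEquiv c m (a :: l) (a :: l') :=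
  ⟨by simp [h.1], fun y => by
    have := mulSq_prodErase_mem hc (hL _) a (h.2 y)
    rwa [map_sub] at this⟩

lemma sum_eq_add_add_sum_erase {M : Type*} [AddCommMonoid M] (f : σ → M) {a b : σ} (hab : a ≠ b) :
    ∑ x, f x = f a + f b + ∑ x ∈ (Finset.univ.erase a).erase b, f x := by
  rw [← Finset.add_sum_erase _ _ (Finset.mem_univ a),
    ← Finset.add_sum_erase _ _ (Finset.mem_erase.2 ⟨hab.symm, Finset.mem_univ b⟩), add_assoc]

/-- The two-index form of a congruence that is obtained from a sum over all variables. -/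
lemma sub_mem_of_sum_mem {K : Submodule (ZMod 2) (𝔓 σ)} {f : σ → 𝔓 σ} {a b : σ} (hab : a ≠ b)
    (h : ∑ x, f x ∈ K) (h' : ∀ x, x ≠ a → x ≠ b → f x ∈ K) : f a - f b ∈ K := by
  rw [sum_eq_add_add_sum_erase f hab] at h
  rw [CharTwo.sub_eq_add]
  refine (Submodule.add_mem_iff_left _ (Submodule.sum_mem _ fun x hx => ?_)).1 h
  rw [Finset.mem_erase, Finset.mem_erase] at hx
  exact h' x hx.2.1 hx.1

lemma X_mul_prod_erase_erase {a b : σ} (hab : a ≠ b) :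
    X a * ∏ x ∈ (Finset.univ.erase a).erase b, X x = (prodErase b : 𝔓 σ) := by
  rw [Finset.erase_right_comm, prodErase]
  exact Finset.mul_prod_erase _ _ (by simp [hab])

lemma IsLow.X_mul_prod_mul_sq_mem {n : ℕ} (h : IsLow σ n) {a b x : σ} (hab : a ≠ b)
    (hxa : x ≠ a) (hxb : x ≠ b) (z : 𝔓 σ) :
    X x * ((∏ x ∈ (Finset.univ.erase a).erase b, X x) * z ^ 2) ∈ cohitKer σ n := by
  have := h.prod_mul_sq_mem (((Finset.univ.erase a).erase b).erase x) hab (by simp) (by simp)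
    (X x * z)
  rw [← Finset.mul_prod_erase ((Finset.univ.erase a).erase b) X (a := x) (by simp [hxa, hxb])]
  convert this using 1
  ring

lemma KamekoEquiv.swap (hc : Fintype.card σ = c + 1) (hL : ∀ j, IsLow σ (lev c m (j + 1)))
    (a b : σ) (l : List σ) : KamekoEquiv c m (a :: b :: l) (b :: a :: l) := by
  by_cases hab : a = b
  · subst hab
    exact .refl _
  refine ⟨rfl, fun y => ?_⟩
  set Y : 𝔓 σ := ∏ x ∈ (Finset.univ.erase a).erase b, X x with hY
  have h1 : X a * Y = prodErase b := X_mul_prod_erase_erase hab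
  have h2 : X b * Y = prodErase a := by
    rw [← X_mul_prod_erase_erase (Ne.symm hab), hY, Finset.erase_right_comm]
  have := sub_mem_of_sum_mem hab
    (sum_prodErase_mul_sq_mem (lev c m (l.length + 2)) (Y * kameko l y ^ 2)) fun x hxa hxb =>
    mulSq_prodErase_mem hc (hL _) x ((hL _).X_mul_prod_mul_sq_mem hab hxa hxb _)
  rw [← mul_assoc, h1, ← mul_assoc, h2] at this
  exact this

lemma KamekoEquiv.square_swap (hc : Fintype.card σ = c + 1)
    (hL : ∀ j, IsLow σ (lev c m (j + 1))) (a b : σ) (l : List σ) :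
    KamekoEquiv c m (a :: a :: b :: l) (b :: b :: a :: l) := by
  by_cases hab : a = b
  · subst hab
    exact .refl _
  refine ⟨rfl, fun y => ?_⟩
  set Y : 𝔓 σ := ∏ x ∈ (Finset.univ.erase a).erase b, X x with hY
  set z := kameko l y
  have h1 : X a * Y = prodErase b := X_mul_prod_erase_erase hab
  have h2 : X b * Y = prodErase a := by
    rw [← X_mul_prod_erase_erase (Ne.symm hab), hY, Finset.erase_right_comm]
  have h3 : ∀ x : σ, X x * ((∏ x, X x) * (Y * z ^ 2) ^ 2) =
      prodErase x * (X x * Y * z ^ 2) ^ 2 := fun x => by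
    rw [← X_mul_prodErase x]; ring
  have := sub_mem_of_sum_mem hab
    (sum_prodErase_mul_sq_mem (lev c m (l.length + 3)) ((∏ x, X x) * (Y * z ^ 2) ^ 2))
    fun x hxa hxb => by
      rw [h3, mul_assoc]
      exact mulSq_prodErase_mem hc (hL _) x (mulSq_prodErase_mem hc (hL _) x
        ((hL _).X_mul_prod_mul_sq_mem hab hxa hxb _))
  rw [h3, h3, h1, h2] at this
  exact this

lemma KamekoEquiv.dup_swap (hc : Fintype.card σ = c + 1) (hL : ∀ j, IsLow σ (lev c m (j + 1)))
    (a b : σ) (l : List σ) : KamekoEquiv c m (a :: a :: b :: l) (a :: b :: b :: l) :=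
  (square_swap hc hL a b l).trans (((swap hc hL b a l).cons hc hL b).trans
    (swap hc hL b a (b :: l)))

end Kameko

section Lists

/-- A relation on lists that is compatible with `cons`, allows permutations and allows to
exchange repeated entries only depends on the length and the set of entries. -/
lemma List.rel_of_length_eq_of_toFinset_eq {α : Type*} [DecidableEq α] (R : List α → List α → Prop)
    (refl : ∀ l, R l l)
    (trans : ∀ {l l' l''}, R l l' → R l' l'' → R l l'')
    (cons : ∀ a {l l'}, R l l' → R (a :: l) (a :: l'))
    (swap : ∀ a b l, R (a :: b :: l) (b :: a :: l))
    (dup : ∀ a b l, R (a :: a :: b :: l) (a :: b :: b :: l)) {l l' : List α}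
    (hlen : l.length = l'.length) (hset : l.toFinset = l'.toFinset) : R l l' := by
  have perm : ∀ {l l' : List α}, l.Perm l' → R l l' := fun h => by
    induction h with
    | nil => exact refl _
    | cons x _ ih => exact cons x ih
    | swap x y l => exact swap y x l
    | trans _ _ ih1 ih2 => exact trans ih1 ih2
  have exch : ∀ {a b : α} {l : List α}, a ∈ l → b ∈ l → R (a :: l) (b :: l) := by
    intro a b l ha hb
    by_cases hab : a = b
    · subst hab; exact refl _
    have h1 := List.perm_cons_erase ha
    have h2 := List.perm_cons_erase ((List.mem_erase_of_ne (Ne.symm hab)).2 hb)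
    have h3 : l.Perm (a :: b :: (l.erase a).erase b) := h1.trans (h2.cons a)
    exact trans (perm (h3.cons a)) (trans (dup a b _) (trans (swap a b _)
      (perm (h3.symm.cons b))))
  have rep : ∀ {l : List α}, ¬ l.Nodup → ∃ a p, l.Perm (a :: p) ∧ a ∈ p := by
    intro l hl
    obtain ⟨a, ha⟩ := List.exists_duplicate_iff_not_nodup.2 hl
    refine ⟨a, l.erase a, List.perm_cons_erase ha.mem, ?_⟩
    rw [List.duplicate_iff_two_le_count] at ha
    rw [← List.count_pos_iff, List.count_erase_self]
    omega
  induction hn : l.length generalizing l l' with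
  | zero =>
    rw [hn] at hlen
    rw [List.length_eq_zero_iff.1 hn, List.length_eq_zero_iff.1 hlen.symm]
    exact refl _
  | succ n ih =>
    by_cases hl : l.Nodup
    · refine perm (List.perm_of_nodup_nodup_toFinset_eq hl ?_ hset)
      rw [← Multiset.coe_nodup, ← Multiset.toFinset_card_eq_card_iff_nodup]
      rw [← Multiset.coe_nodup, ← Multiset.toFinset_card_eq_card_iff_nodup] at hl
      simpa [hset, hlen] using hl
    · have hl' : ¬ l'.Nodup := fun h => hl <| by
        rw [← Multiset.coe_nodup, ← Multiset.toFinset_card_eq_card_iff_nodup] at h ⊢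
        simpa [hset, hlen] using h
      obtain ⟨a, p, hp, ha⟩ := rep hl
      obtain ⟨b, q, hq, hb⟩ := rep hl'
      have hpq : p.toFinset = q.toFinset := by
        rw [List.toFinset_eq_of_perm _ _ hp, List.toFinset_eq_of_perm _ _ hq, List.toFinset_cons,
          List.toFinset_cons, Finset.insert_eq_of_mem (List.mem_toFinset.2 ha),
          Finset.insert_eq_of_mem (List.mem_toFinset.2 hb)] at hset
        exact hset
      have hp' := hp.length_eq
      have hq' := hq.length_eq
      rw [List.length_cons] at hp' hq'
      have haq : a ∈ q := by rwa [← List.mem_toFinset, ← hpq, List.mem_toFinset]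
      exact trans (perm hp) (trans (cons a (ih (by omega) hpq (by omega)))
        (trans (exch haq hb) (perm hq.symm)))

lemma List.exists_toFinset_eq {α : Type*} [DecidableEq α] (S : Finset α) (hS : S.Nonempty)
    {d : ℕ} (hd : S.card ≤ d) :
    ∃ l : List α, l.length = d ∧ l.toFinset = S := by
  obtain ⟨a, ha⟩ := hS
  refine ⟨List.replicate (d - S.card) a ++ S.toList, by simp [hd], ?_⟩
  ext x
  simp only [List.toFinset_append, Finset.toList_toFinset, Finset.mem_union, List.mem_toFinset,
    List.mem_replicate, or_iff_right_iff_imp]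
  rintro ⟨-, rfl⟩
  exact ha

end Lists

section Arithmetic

lemma Multiset.card_le_of_sum_two_pow_eq (E : Finset ℕ) (s : Multiset ℕ)
    (h : (s.map (2 ^ ·)).sum = ∑ e ∈ E, 2 ^ e) : E.card ≤ s.card := by
  induction hn : s.card using Nat.strong_induction_on generalizing s with
  | _ n ih =>
    by_cases hs : s.Nodup
    · have : s.toFinset = E := Finset.geomSum_injective le_rfl (by
        change _ = ∑ e ∈ E, 2 ^ e
        rw [← h]
        simp only [Finset.sum, Multiset.toFinset_val, hs.dedup])
      rw [← hn, ← this]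
      exact Multiset.toFinset_card_le s
    · rw [Multiset.nodup_iff_le] at hs
      push Not at hs
      obtain ⟨x, hx⟩ := hs
      obtain ⟨t, rfl⟩ := Multiset.le_iff_exists_add.1 hx
      have hcard : (x ::ₘ x ::ₘ (0 : Multiset ℕ) + t).card = t.card + 2 := by simp
      have := ih (t.card + 1) (by omega) ((x + 1) ::ₘ t) (by
        rw [← h]; simp [pow_succ]; ring) (by simp)
      omega

end Arithmetic

section Spanning

variable {σ : Type*}

local notation "𝔓" σ => MvPolynomial σ (ZMod 2)

/-- The exponents halved and rounded down. -/
noncomputable def halfExp (e : σ →₀ ℕ) : σ →₀ ℕ := e.mapRange (· / 2) rfl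

lemma exp_eq_sum_add_halfExp [Fintype σ] (e : σ →₀ ℕ) :
    e = ∑ x with Odd (e x), Finsupp.single x 1 + 2 • halfExp e := by
  classical
  ext x
  rw [Finsupp.add_apply, Finsupp.finsetSum_apply]
  simp only [Finsupp.single_apply, Finset.sum_ite_eq', Finset.mem_filter, Finset.mem_univ,
    true_and, Finsupp.smul_apply, halfExp, Finsupp.mapRange_apply, smul_eq_mul]
  split_ifs with h
  · rw [Nat.odd_iff] at h; omega
  · rw [Nat.not_odd_iff] at h; omega

lemma monomial_eq_prod_mul_sq [Fintype σ] (e : σ →₀ ℕ) :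
    (monomial e 1 : 𝔓 σ) = (∏ x with Odd (e x), X x) * monomial (halfExp e) 1 ^ 2 := by
  conv_lhs => rw [exp_eq_sum_add_halfExp e]
  rw [prod_X_eq_monomial, monomial_pow, monomial_mul, one_pow, mul_one]

lemma degree_eq_card_add [Fintype σ] (e : σ →₀ ℕ) :
    e.degree = (Finset.univ.filter fun x => Odd (e x)).card + 2 * (halfExp e).degree := by
  conv_lhs => rw [exp_eq_sum_add_halfExp e]
  simp [map_sum, Finset.sum_const]

variable [Fintype σ] [DecidableEq σ]

/-- Monomials with two even exponents are hit in degrees that are sums of one less than the number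
of variables distinct integers `2 ^ f - 1`. -/
lemma isLow_of_eq_sum {ι : Type*} {c n : ℕ} (hc : Fintype.card σ = c + 1) (I : Finset ι)
    (hI : I.card = c) (f : ι → ℕ) (hf : Set.InjOn f I) (hf1 : ∀ i ∈ I, 1 ≤ f i)
    (hn : n = ∑ i ∈ I, (2 ^ f i - 1)) : IsLow σ n := by
  intro e a b hab ha hb
  by_cases he : e.degree = n
  swap
  · exact monomial_mem_cohitKer he
  have hd := degree_eq_card_add e
  set S := Finset.univ.filter fun x => Odd (e x) with hS
  have hSc : S.card + 2 ≤ c + 1 := by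
    rw [← hc, ← Finset.card_pair hab, ← Finset.card_union_of_disjoint]
    · exact Finset.card_le_univ _
    · rw [Finset.disjoint_right]
      intro x hx
      rw [hS, Finset.mem_filter, ← Nat.not_even_iff_odd]
      rcases Finset.mem_insert.1 hx with rfl | hx
      · simp [ha]
      · simp [Finset.mem_singleton.1 hx, hb]
  rw [monomial_eq_prod_mul_sq, ← stSq_degree_monomial]
  refine prod_X_mul_stSq_mem _ (fun i f hi => stSq_mem_cohitKer _ hi f) _ _ _ fun j hj => ?_
  exfalso
  have h1 : ∑ x ∈ S, 2 ^ (j x + 1) = 2 * ((halfExp e).degree + S.card) := by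
    rw [← hj, Finset.card_eq_sum_ones, ← Finset.sum_add_distrib, Finset.mul_sum]
    refine Finset.sum_congr rfl fun x _ => ?_
    have := Nat.two_pow_pos (j x)
    rw [pow_succ]; omega
  have h2 : ∑ i ∈ I, 2 ^ f i = n + c := by
    rw [hn, ← hI, Finset.card_eq_sum_ones, ← Finset.sum_add_distrib]
    refine Finset.sum_congr rfl fun x _ => ?_
    have := Nat.two_pow_pos (f x)
    omega
  have h3 : 2 ∣ ∑ i ∈ I, 2 ^ f i :=
    Finset.dvd_sum fun i hi => dvd_pow_self 2 (by have := hf1 i hi; omega)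
  have := Multiset.card_le_of_sum_two_pow_eq (I.image f)
    (S.val.map (fun x => j x + 1) + Multiset.replicate ((c - S.card) / 2) 1) (by
      rw [Finset.sum_image hf, h2, Multiset.map_add, Multiset.sum_add, Multiset.map_map,
        Multiset.map_replicate, Multiset.sum_replicate]
      change ∑ x ∈ S, 2 ^ (j x + 1) + _ = _
      rw [h1, smul_eq_mul]
      omega)
  rw [Finset.card_image_of_injOn hf, Multiset.card_add, Multiset.card_map,
    Multiset.card_replicate, Finset.card_val] at this
  omega

variable {c m : ℕ}

lemma mem_sup_iSup_kameko (hc : Fintype.card σ = c + 1) (hL : ∀ j, IsLow σ (lev c m (j + 1)))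
    (j : ℕ) (f : 𝔓 σ) : f ∈ cohitKer σ (lev c m j) ⊔
      ⨆ l : {l : List σ // l.length = j}, LinearMap.range (kameko l.1) := by
  induction j generalizing f with
  | zero =>
    exact Submodule.mem_sup_right (Submodule.mem_iSup_of_mem ⟨[], rfl⟩ ⟨f, rfl⟩)
  | succ j ih =>
    refine MvPolynomial.mem_of_support _ _ fun e _ => ?_
    by_cases he : e.degree = lev c m (j + 1)
    swap
    · exact Submodule.mem_sup_left (monomial_mem_cohitKer he)
    by_cases hlow : ∃ a b, a ≠ b ∧ Even (e a) ∧ Even (e b)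
    · obtain ⟨a, b, hab, ha, hb⟩ := hlow
      exact Submodule.mem_sup_left (hL j e a b hab ha hb)
    have hd := degree_eq_card_add e
    obtain ⟨a, ha⟩ : ∃ a, Even (e a) := by
      by_contra! hcon
      rw [Finset.filter_true_of_mem (fun x _ => Nat.not_even_iff_odd.1 (hcon x)),
        Finset.card_univ, hc, he, lev] at hd
      omega
    have hS : Finset.univ.filter (fun x => Odd (e x)) = Finset.univ.erase a := by
      ext x
      rw [Finset.mem_filter, Finset.mem_erase, and_comm, ← Nat.not_even_iff_odd]
      refine and_congr_left fun _ => ⟨?_, fun h hx => hlow ⟨x, a, h, hx, ha⟩⟩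
      rintro h rfl
      exact h ha
    rw [monomial_eq_prod_mul_sq, hS]
    have hle : cohitKer σ (lev c m j) ⊔
      ⨆ l : {l : List σ // l.length = j}, LinearMap.range (kameko l.1) ≤
        (cohitKer σ (lev c m (j + 1)) ⊔ ⨆ l : {l : List σ // l.length = j + 1},
          LinearMap.range (kameko l.1)).comap (mulSq (prodErase a)) := by
      refine sup_le (fun y hy => Submodule.mem_sup_left (mulSq_prodErase_mem hc (hL j) a hy))
        (iSup_le ?_)
      rintro ⟨l, hl⟩ _ ⟨y, rfl⟩
      exact Submodule.mem_sup_right (Submodule.mem_iSup_of_mem ⟨a :: l, by simp [hl]⟩ ⟨y, rfl⟩)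
    exact hle (ih _)

lemma lev_lev_one (c m j : ℕ) : lev c (lev c m 1) j = lev c m (j + 1) := by
  induction j with
  | zero => rfl
  | succ j ih => rw [lev, ih]; rfl

lemma kameko_append_singleton (t : List σ) (a : σ) (y : 𝔓 σ) :
    kameko (t ++ [a]) y = kameko t (prodErase a * y ^ 2) := by
  induction t with
  | nil => rfl
  | cons b t ih => rw [List.cons_append, kameko_cons, ih]; rfl

lemma sum_kameko_append_mem (hc : Fintype.card σ = c + 1) (hL : ∀ j, IsLow σ (lev c m (j + 1)))
    (t : List σ) (g : 𝔓 σ) :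
    ∑ a, kameko (t ++ [a]) (X a * g) ∈ cohitKer σ (lev c m (t.length + 1)) := by
  simp only [kameko_append_singleton, ← map_sum]
  rw [← lev_lev_one]
  refine kameko_mem hc (fun j => ?_) t (sum_prodErase_mul_sq_mem _ g)
  rw [lev_lev_one]
  exact hL _

lemma exists_kameko_replicate_eq (j : ℕ) (g : 𝔓 σ) :
    ∃ G, ∀ x, kameko (List.replicate j x) (X x * g) = X x * G := by
  induction j with
  | zero => exact ⟨g, fun _ => rfl⟩
  | succ j ih =>
    obtain ⟨G, hG⟩ := ih
    refine ⟨(∏ x, X x) * G ^ 2, fun x => ?_⟩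
    rw [List.replicate_succ, kameko_cons, hG, ← X_mul_prodErase x]
    ring

lemma sum_kameko_replicate_mem (n j : ℕ) (g : 𝔓 σ) :
    ∑ a, kameko (List.replicate (j + 1) a) (X a * g) ∈ cohitKer σ n := by
  obtain ⟨G, hG⟩ := exists_kameko_replicate_eq j g
  simp only [List.replicate_succ, kameko_cons, hG]
  exact sum_prodErase_mul_sq_mem n G

open Classical in
/-- The Kameko map attached to a set of variables: the one of any list of length `d` with this set
of entries, with values in the cohits. -/
noncomputable def kamekoSet (c m d : ℕ) (S : Finset σ) :
    (𝔓 σ) →ₗ[ZMod 2] (𝔓 σ) ⧸ cohitKer σ (lev c m d) :=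
  if h : ∃ l : List σ, l.length = d ∧ l.toFinset = S then
    (cohitKer σ (lev c m d)).mkQ ∘ₗ kameko h.choose else 0

lemma kamekoSet_toFinset (hc : Fintype.card σ = c + 1) (hL : ∀ j, IsLow σ (lev c m (j + 1)))
    {d : ℕ} (l : List σ) (hl : l.length = d) (y : 𝔓 σ) :
    kamekoSet c m d l.toFinset y = (cohitKer σ (lev c m d)).mkQ (kameko l y) := by
  have h : ∃ l' : List σ, l'.length = d ∧ l'.toFinset = l.toFinset := ⟨l, hl, rfl⟩
  have hR : KamekoEquiv c m h.choose l :=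
    List.rel_of_length_eq_of_toFinset_eq (KamekoEquiv c m) .refl .trans
      (fun a _ _ h => h.cons hc hL a) (KamekoEquiv.swap hc hL) (KamekoEquiv.dup_swap hc hL)
      (h.choose_spec.1.trans hl.symm) h.choose_spec.2
  rw [kamekoSet, dif_pos h, LinearMap.comp_apply, Submodule.mkQ_apply, Submodule.mkQ_apply,
    Submodule.Quotient.eq]
  have := hR.2 y
  rwa [h.choose_spec.1] at this

lemma kamekoSet_eq_zero_of_mem (hc : Fintype.card σ = c + 1)
    (hL : ∀ j, IsLow σ (lev c m (j + 1))) (d : ℕ) (S : Finset σ) {y : 𝔓 σ}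
    (hy : y ∈ cohitKer σ m) : kamekoSet c m d S y = 0 := by
  by_cases h : ∃ l : List σ, l.length = d ∧ l.toFinset = S
  · obtain ⟨l, hl, rfl⟩ := h
    rw [kamekoSet_toFinset hc hL l hl, Submodule.mkQ_apply, Submodule.Quotient.mk_eq_zero, ← hl]
    exact kameko_mem hc hL l hy
  · rw [kamekoSet, dif_neg h, LinearMap.zero_apply]

lemma sum_kamekoSet_insert (hc : Fintype.card σ = c + 1) (hL : ∀ j, IsLow σ (lev c m (j + 1)))
    (d : ℕ) {T : Finset σ} (hT : T.card ≤ d) (g : 𝔓 σ) :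
    ∑ a, kamekoSet c m (d + 1) (insert a T) (X a * g) = 0 := by
  obtain rfl | hne := T.eq_empty_or_nonempty
  · have h : ∀ a : σ, insert a (∅ : Finset σ) = (List.replicate (d + 1) a).toFinset := fun a => by
      rw [List.toFinset_replicate_of_ne_zero d.succ_ne_zero]; rfl
    simp only [h]
    rw [Finset.sum_congr rfl fun a _ => kamekoSet_toFinset hc hL _ (by simp) _, ← map_sum,
      Submodule.mkQ_apply, Submodule.Quotient.mk_eq_zero]
    exact sum_kameko_replicate_mem _ d g
  · obtain ⟨t, rfl, rfl⟩ := List.exists_toFinset_eq T hne hT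
    have h : ∀ a : σ, insert a t.toFinset = (t ++ [a]).toFinset := fun a => by
      ext x; simp
    simp only [h]
    rw [Finset.sum_congr rfl fun a _ => kamekoSet_toFinset hc hL _ (by simp) _, ← map_sum,
      Submodule.mkQ_apply, Submodule.Quotient.mk_eq_zero]
    exact sum_kameko_append_mem hc hL t g

lemma iSup_range_kamekoSet (hc : Fintype.card σ = c + 1) (hL : ∀ j, IsLow σ (lev c m (j + 1)))
    (d : ℕ) : ⨆ S : {S : Finset σ // S.Nonempty}, LinearMap.range (kamekoSet c m (d + 1) S.1) = ⊤ := by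
  refine eq_top_iff.2 fun v _ => ?_
  obtain ⟨f, rfl⟩ := Submodule.mkQ_surjective _ v
  have hle : cohitKer σ (lev c m (d + 1)) ⊔
      ⨆ l : {l : List σ // l.length = d + 1}, LinearMap.range (kameko l.1) ≤
      (⨆ S : {S : Finset σ // S.Nonempty}, LinearMap.range (kamekoSet c m (d + 1) S.1)).comap
        (cohitKer σ (lev c m (d + 1))).mkQ := by
    refine sup_le (fun y hy => ?_) (iSup_le ?_)
    · rw [Submodule.mem_comap, Submodule.mkQ_apply, (Submodule.Quotient.mk_eq_zero _).2 hy]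
      exact Submodule.zero_mem _
    · rintro ⟨l, hl⟩ _ ⟨y, rfl⟩
      rw [Submodule.mem_comap, ← kamekoSet_toFinset hc hL l hl]
      refine Submodule.mem_iSup_of_mem ⟨l.toFinset, ?_⟩ ⟨y, rfl⟩
      rw [List.toFinset_nonempty_iff]
      rintro rfl
      simp at hl
  exact hle (mem_sup_iSup_kameko hc hL _ f)

end Spanning

section Down

variable {τ : Type*}

local notation "𝔓" σ => MvPolynomial σ (ZMod 2)

open Classical in
/-- The down Kameko map, sending `(∏ x, X x) * y ^ 2` to `y` and monomials with an even exponent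
to zero. -/
noncomputable def downKameko (τ : Type*) :
    MvPolynomial τ (ZMod 2) →ₗ[ZMod 2] MvPolynomial τ (ZMod 2) :=
  (basisMonomials τ (ZMod 2)).constr (ZMod 2)
    fun e => if ∀ x, Odd (e x) then monomial (halfExp e) 1 else 0

lemma downKameko_monomial (e : τ →₀ ℕ) [Decidable (∀ x, Odd (e x))] :
    downKameko τ (monomial e 1) = if ∀ x, Odd (e x) then monomial (halfExp e) 1 else 0 := by
  have := (basisMonomials τ (ZMod 2)).constr_basis (ZMod 2)
    (fun e => open Classical in if ∀ x, Odd (e x) then (monomial (halfExp e) 1 : 𝔓 τ) else 0) e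
  rw [coe_basisMonomials] at this
  rw [downKameko, this]
  congr

lemma MvPolynomial.linearMap_eq_of_monomial {M : Type*} [AddCommMonoid M] [Module (ZMod 2) M]
    {A B : (𝔓 τ) →ₗ[ZMod 2] M} (h : ∀ e, A (monomial e 1) = B (monomial e 1)) (f : 𝔓 τ) :
    A f = B f :=
  MvPolynomial.mem_of_support (LinearMap.eqLocus A B) f fun e _ => h e

lemma downKameko_mul_sq (p q : 𝔓 τ) : downKameko τ (p * q ^ 2) = downKameko τ p * q := by
  classical
  suffices h : ∀ e, downKameko τ (monomial e 1 * q ^ 2) = downKameko τ (monomial e 1) * q by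
    have := MvPolynomial.linearMap_eq_of_monomial
      (A := downKameko τ ∘ₗ LinearMap.mulRight (ZMod 2) (q ^ 2))
      (B := LinearMap.mulRight (ZMod 2) q ∘ₗ downKameko τ)
      (fun e => by simpa only [LinearMap.comp_apply, LinearMap.mulRight_apply] using h e) p
    simpa only [LinearMap.comp_apply, LinearMap.mulRight_apply] using this
  intro e
  suffices h : ∀ f, downKameko τ (monomial e 1 * monomial f 1 ^ 2) =
      downKameko τ (monomial e 1) * monomial f 1 by
    have := MvPolynomial.linearMap_eq_of_monomial
      (A := downKameko τ ∘ₗ mulSq (monomial e 1))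
      (B := LinearMap.mulLeft (ZMod 2) (downKameko τ (monomial e 1)))
      (fun f => by simpa only [LinearMap.comp_apply, mulSq_apply, LinearMap.mulLeft_apply] using h f)
      q
    simpa only [LinearMap.comp_apply, mulSq_apply, LinearMap.mulLeft_apply] using this
  intro f
  have ho : (∀ x, Odd ((e + 2 • f) x)) ↔ ∀ x, Odd (e x) :=
    forall_congr' fun x => by simp [Nat.odd_add]
  rw [monomial_pow, monomial_mul, one_pow, one_mul, downKameko_monomial, downKameko_monomial]
  simp only [ho]
  split_ifs
  · rw [monomial_mul, one_mul, show halfExp (e + 2 • f) = halfExp e + f from ?_]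
    ext x
    simp only [halfExp, Finsupp.mapRange_apply, Finsupp.add_apply, Finsupp.smul_apply,
      smul_eq_mul]
    omega
  · rw [zero_mul]

lemma stSq_prod_X [DecidableEq τ] (s : Finset τ) (p : ℕ) :
    stSq τ p (∏ x ∈ s, X x) = ∑ t ∈ s.powerset,
      if (s \ t).card = p then (∏ x ∈ t, X x) * (∏ x ∈ s \ t, X x) ^ 2 else 0 := by
  rw [stSq_apply, map_prod]
  simp only [sqPoly_X]
  rw [Finset.prod_add, Polynomial.finsetSum_coeff]
  refine Finset.sum_congr rfl fun t _ => ?_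
  rw [Finset.prod_mul_distrib, Finset.prod_const, ← map_prod, ← map_prod, Polynomial.coeff_C_mul,
    Polynomial.coeff_X_pow_mul', Polynomial.coeff_C, Finset.prod_pow, mul_ite]
  split_ifs <;> first | rfl | omega | simp

variable [Fintype τ] [DecidableEq τ]

lemma downKameko_prod_X (s : Finset τ) :
    downKameko τ (∏ x ∈ s, X x) = if s = Finset.univ then 1 else 0 := by
  have hv : ∀ y, (∑ x ∈ s, Finsupp.single x 1 : τ →₀ ℕ) y = if y ∈ s then 1 else 0 := fun y => by
    rw [Finsupp.finsetSum_apply]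
    simp [Finsupp.single_apply]
  rw [prod_X_eq_monomial, downKameko_monomial]
  have h1 : (∀ x, Odd ((∑ x ∈ s, Finsupp.single x 1 : τ →₀ ℕ) x)) ↔ s = Finset.univ := by
    rw [Finset.eq_univ_iff_forall]
    refine forall_congr' fun x => ?_
    rw [hv]
    split_ifs with h <;> simp [h]
  simp only [h1]
  refine if_congr Iff.rfl ?_ rfl
  rw [show halfExp (∑ x ∈ s, Finsupp.single x 1 : τ →₀ ℕ) = 0 from ?_]
  · rfl
  · ext y
    rw [halfExp, Finsupp.mapRange_apply, hv]
    split_ifs <;> rfl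

lemma downKameko_stSq_prod_X (s : Finset τ) {p : ℕ} (hp : 0 < p) :
    downKameko τ (stSq τ p (∏ x ∈ s, X x)) = 0 := by
  rw [stSq_prod_X, map_sum]
  refine Finset.sum_eq_zero fun t ht => ?_
  split_ifs with h
  · rw [downKameko_mul_sq, downKameko_prod_X, if_neg, zero_mul]
    rintro rfl
    rw [Finset.eq_empty_of_forall_notMem fun x hx => (Finset.mem_sdiff.1 hx).2 (Finset.mem_univ x)] at h
    exact hp.ne h
  · exact map_zero _

lemma downKameko_mem {k n : ℕ} (hk : Fintype.card τ = k) {f : 𝔓 τ}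
    (hf : f ∈ cohitKer τ (k + 2 * n)) : downKameko τ f ∈ cohitKer τ n := by
  refine cohitKer_le (p := (cohitKer τ n).comap (downKameko τ)) (fun i e hi => ?_)
    (fun e he => ?_) hf
  · rw [Submodule.mem_comap, monomial_eq_prod_mul_sq, stSq_mul, map_sum]
    refine Submodule.sum_mem _ ?_
    rintro ⟨p, q⟩ hpq
    rw [Finset.HasAntidiagonal.mem_antidiagonal] at hpq
    obtain ⟨q, rfl | rfl⟩ := q.even_or_odd'
    · dsimp only at hpq ⊢
      rw [stSq_pow_two, downKameko_mul_sq]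
      rcases p.eq_zero_or_pos with rfl | hp
      · rw [stSq_zero, downKameko_prod_X, ite_mul, one_mul, zero_mul]
        split_ifs
        · exact stSq_mem_cohitKer n (by omega) _
        · exact Submodule.zero_mem _
      · rw [downKameko_stSq_prod_X _ hp, zero_mul]
        exact Submodule.zero_mem _
    · rw [stSq_pow_two_of_odd ⟨q, rfl⟩, mul_zero, map_zero]
      exact Submodule.zero_mem _
  · rw [Submodule.mem_comap, downKameko_monomial]
    split_ifs with h
    · refine monomial_mem_cohitKer fun h' => he ?_
      rw [degree_eq_card_add, Finset.filter_true_of_mem fun x _ => h x, Finset.card_univ, hk, h']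
    · exact Submodule.zero_mem _

lemma downKameko_iterate_mem {k m : ℕ} (hk : Fintype.card τ = k) (d : ℕ) {f : 𝔓 τ}
    (hf : f ∈ cohitKer τ (lev k m d)) : (downKameko τ ^ d) f ∈ cohitKer τ m := by
  induction d generalizing f with
  | zero => exact hf
  | succ d ih =>
    rw [pow_succ, Module.End.mul_apply]
    exact ih (downKameko_mem hk hf)

end Down

section Collapse

variable {k : ℕ}

local notation "𝔓" σ => MvPolynomial σ (ZMod 2)

/-- An element of `H`, provided `H` is nonempty. -/
noncomputable def pivot (H : Finset (Fin (k + 1))) : Fin (k + 1) :=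
  if h : H.Nonempty then H.min' h else 0

lemma pivot_mem {H : Finset (Fin (k + 1))} (h : H.Nonempty) : pivot H ∈ H := by
  rw [pivot, dif_pos h]
  exact H.min'_mem h

/-- The inclusion of polynomials that leaves out the variable `pivot H`. -/
noncomputable def inflate (H : Finset (Fin (k + 1))) : (𝔓 (Fin k)) →ₐ[ZMod 2] 𝔓 (Fin (k + 1)) :=
  rename (pivot H).succAbove

/-- The elimination of the variable `pivot H` by the relation `∑ a ∈ H, X a = 0`. -/
noncomputable def collapse (H : Finset (Fin (k + 1))) : (𝔓 (Fin (k + 1))) →ₐ[ZMod 2] 𝔓 (Fin k) :=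
  aeval ((pivot H).insertNth (α := fun _ => 𝔓 (Fin k))
    (∑ b with (pivot H).succAbove b ∈ H, X b) X)

variable (H : Finset (Fin (k + 1)))

lemma collapse_X_pivot : collapse H (X (pivot H)) = ∑ b with (pivot H).succAbove b ∈ H, X b := by
  simp [collapse]

lemma collapse_X_succAbove (b : Fin k) : collapse H (X ((pivot H).succAbove b)) = X b := by
  simp [collapse]

lemma inflate_X (b : Fin k) : inflate H (X b) = X ((pivot H).succAbove b) := rename_X _ _

lemma collapse_inflate (y : 𝔓 (Fin k)) : collapse H (inflate H y) = y := by
  have : (collapse H).comp (inflate H) = AlgHom.id _ _ :=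
    MvPolynomial.algHom_ext fun b => by
      rw [AlgHom.comp_apply, inflate_X, collapse_X_succAbove, AlgHom.id_apply]
  exact DFunLike.congr_fun this y

lemma collapse_mem {n : ℕ} {f : 𝔓 (Fin (k + 1))} (hf : f ∈ cohitKer _ n) :
    collapse H f ∈ cohitKer (Fin k) n := by
  refine map_mem_cohitKer (collapse H) ((pivot H).insertNth (α := fun _ => Finset (Fin k))
    (Finset.univ.filter fun b => (pivot H).succAbove b ∈ H) fun b => {b}) (fun j => ?_) hf
  obtain rfl | ⟨b, rfl⟩ := (pivot H).eq_self_or_eq_succAbove j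
  · rw [collapse_X_pivot, Fin.insertNth_apply_same]
  · rw [collapse_X_succAbove, Fin.insertNth_apply_succAbove, Finset.sum_singleton]

lemma inflate_mem {n : ℕ} {f : 𝔓 (Fin k)} (hf : f ∈ cohitKer _ n) :
    inflate H f ∈ cohitKer (Fin (k + 1)) n :=
  map_mem_cohitKer (inflate H) (fun b => {(pivot H).succAbove b})
    (fun b => by rw [inflate_X, Finset.sum_singleton]) hf

variable {H}

lemma sum_X_eq_X_pivot_add (hH : H.Nonempty) : (∑ a ∈ H, X a : 𝔓 (Fin (k + 1))) =
    X (pivot H) + inflate H (∑ b with (pivot H).succAbove b ∈ H, X b) := by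
  have h : (∑ a ∈ H, X a : 𝔓 (Fin (k + 1))) = ∑ a, if a ∈ H then X a else 0 := by simp
  rw [h, Fin.sum_univ_succAbove _ (pivot H), if_pos (pivot_mem hH), Finset.sum_filter, map_sum]
  refine congrArg _ (Finset.sum_congr rfl fun b _ => ?_)
  split_ifs
  · rw [inflate_X]
  · rw [map_zero]

lemma collapse_sum_X (hH : H.Nonempty) : collapse H (∑ a ∈ H, X a) = 0 := by
  rw [sum_X_eq_X_pivot_add hH, map_add, collapse_inflate, collapse_X_pivot, CharTwo.add_self_eq_zero]

lemma exists_eq_inflate_collapse_add (hH : H.Nonempty) (y : 𝔓 (Fin (k + 1))) :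
    ∃ g, y = inflate H (collapse H y) + (∑ a ∈ H, X a) * g := by
  have : (Ideal.Quotient.mkₐ (ZMod 2) (Ideal.span {(∑ a ∈ H, X a : 𝔓 (Fin (k + 1)))})).comp
      ((inflate H).comp (collapse H)) = Ideal.Quotient.mkₐ (ZMod 2) _ := by
    refine MvPolynomial.algHom_ext fun j => ?_
    rw [AlgHom.comp_apply, AlgHom.comp_apply, Ideal.Quotient.mkₐ_eq_mk, Ideal.Quotient.eq]
    obtain rfl | ⟨b, rfl⟩ := (pivot H).eq_self_or_eq_succAbove j
    · rw [collapse_X_pivot, CharTwo.sub_eq_add]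
      refine (congrArg (· ∈ _) ((sum_X_eq_X_pivot_add hH).trans (add_comm _ _))).mp ?_
      exact Ideal.mem_span_singleton_self _
    · rw [collapse_X_succAbove, inflate_X, sub_self]
      exact Ideal.zero_mem _
  have h := DFunLike.congr_fun this y
  rw [AlgHom.comp_apply, AlgHom.comp_apply, Ideal.Quotient.mkₐ_eq_mk, eq_comm, Ideal.Quotient.eq,
    Ideal.mem_span_singleton] at h
  obtain ⟨g, hg⟩ := h
  exact ⟨g, by rw [← hg]; ring⟩

lemma downKameko_X_mul_prod_erase (b b' : Fin k) :
    downKameko (Fin k) (X b' * ∏ x ∈ Finset.univ.erase b, X x) = if b' = b then 1 else 0 := by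
  split_ifs with h
  · rw [h, Finset.mul_prod_erase _ _ (Finset.mem_univ b), downKameko_prod_X, if_pos rfl]
  · rw [← Finset.mul_prod_erase (Finset.univ.erase b) X (a := b') (by simp [h]), ← mul_assoc,
      ← sq, mul_comm, downKameko_mul_sq, downKameko_prod_X, if_neg, zero_mul]
    intro h'
    have hb := Finset.mem_univ b
    rw [← h'] at hb
    simp at hb

lemma downKameko_collapse_prodErase (hH : H.Nonempty) (a : Fin (k + 1)) :
    downKameko (Fin k) (collapse H (prodErase a)) = if a ∈ H then 1 else 0 := by
  have he : ∀ a : Fin (k + 1), Finset.univ.erase a = Finset.univ.map a.succAboveEmb := fun a => by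
    ext x
    obtain rfl | ⟨b, rfl⟩ := a.eq_self_or_eq_succAbove x <;> simp
  obtain rfl | ⟨b, rfl⟩ := (pivot H).eq_self_or_eq_succAbove a
  · rw [if_pos (pivot_mem hH), prodErase, he, Finset.prod_map, map_prod]
    simp only [Fin.succAboveEmb_apply, collapse_X_succAbove]
    rw [downKameko_prod_X, if_pos rfl]
  · have hc : prodErase ((pivot H).succAbove b) = X (pivot H) *
        ∏ x ∈ (Finset.univ : Finset (Fin k)).erase b, (X ((pivot H).succAbove x) : 𝔓 _) := by
      rw [prodErase, ← Finset.mul_prod_erase _ _ (a := pivot H) (by simp), Finset.erase_right_comm,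
        he, ← Fin.succAboveEmb_apply, ← Finset.map_erase, Finset.prod_map]
      rfl
    rw [hc, map_mul, map_prod, collapse_X_pivot, Finset.sum_mul, map_sum]
    simp only [collapse_X_succAbove, downKameko_X_mul_prod_erase]
    simp

lemma downKameko_collapse_kameko (hH : H.Nonempty) (l : List (Fin (k + 1)))
    (y : 𝔓 (Fin (k + 1))) : (downKameko (Fin k) ^ l.length) (collapse H (kameko l y)) =
      if l.toFinset ⊆ H then collapse H y else 0 := by
  induction l with
  | nil => simp [kameko]
  | cons a l ih =>
    rw [kameko_cons, map_mul, map_pow, List.length_cons, pow_succ, Module.End.mul_apply,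
      downKameko_mul_sq, downKameko_collapse_prodErase hH, ite_mul, one_mul, zero_mul,
      List.toFinset_cons, apply_ite (downKameko (Fin k) ^ l.length), ih, map_zero, ← ite_and]
    simp only [Finset.insert_subset_iff]

end Collapse

section System

variable {k m : ℕ}

local notation "𝔓" σ => MvPolynomial σ (ZMod 2)

/-- The properties of the Kameko maps attached to the sets of variables that determine their
target: its dual version `proj` detects which summands occur. -/
structure KamekoSystem (k m : ℕ) (V : Type*) [AddCommGroup V] [Module (ZMod 2) V] where
  /-- the map attached to a set of variables -/
  map : Finset (Fin (k + 1)) → MvPolynomial (Fin (k + 1)) (ZMod 2) →ₗ[ZMod 2] V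
  /-- the detecting projections -/
  proj : Finset (Fin (k + 1)) → V →ₗ[ZMod 2] MvPolynomial (Fin k) (ZMod 2) ⧸ cohitKer (Fin k) m
  sum_map_insert : ∀ T g, ∑ a, map (insert a T) (X a * g) = 0
  map_eq_zero : ∀ S, ∀ y ∈ cohitKer (Fin (k + 1)) m, map S y = 0
  proj_map : ∀ H S, H.Nonempty → S.Nonempty → ∀ y,
    proj H (map S y) = if S ⊆ H then (cohitKer (Fin k) m).mkQ (collapse H y) else 0
  iSup_range : ⨆ S : {S : Finset (Fin (k + 1)) // S.Nonempty}, LinearMap.range (map S.1) = ⊤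

namespace KamekoSystem

variable {V : Type*} [AddCommGroup V] [Module (ZMod 2) V] (D : KamekoSystem k m V)
  (H : Finset (Fin (k + 1)))

/-- The sum of the maps over all sets containing `H`. -/
noncomputable def upper : (𝔓 (Fin (k + 1))) →ₗ[ZMod 2] V := ∑ S with H ⊆ S, D.map S

lemma upper_apply (y : 𝔓 (Fin (k + 1))) : D.upper H y = ∑ S with H ⊆ S, D.map S y := by
  rw [upper, LinearMap.sum_apply]

lemma upper_eq_zero_of_mem {y : 𝔓 (Fin (k + 1))} (hy : y ∈ cohitKer _ m) : D.upper H y = 0 := by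
  rw [upper_apply]
  exact Finset.sum_eq_zero fun S _ => D.map_eq_zero S y hy

lemma sum_insert_eq_zero {α : Type*} [Fintype α] [DecidableEq α] (f : Finset α → V)
    {H : Finset α} {a : α} (ha : a ∉ H) : ∑ T with H ⊆ T, f (insert a T) = 0 := by
  refine Finset.sum_involution (fun T _ => if a ∈ T then T.erase a else insert a T)
    (fun T _ => ?_) (fun T _ _ => ?_) (fun T hT => ?_) (fun T _ => ?_)
  · split_ifs with h
    · rw [Finset.insert_eq_of_mem h, Finset.insert_erase h, ZModModule.add_self]
    · rw [Finset.insert_idem, ZModModule.add_self]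
  · split_ifs with h
    · exact Finset.erase_ne_self.2 h
    · exact Finset.insert_ne_self.2 h
  · rw [Finset.mem_filter] at hT ⊢
    refine ⟨Finset.mem_univ _, ?_⟩
    split_ifs with h
    · exact Finset.subset_erase.2 ⟨hT.2, ha⟩
    · exact hT.2.trans (Finset.subset_insert _ _)
  · by_cases h : a ∈ T
    · simp [h]
    · simp [h]

lemma upper_sum_X_mul (g : 𝔓 (Fin (k + 1))) : D.upper H ((∑ a ∈ H, X a) * g) = 0 := by
  have h : ∑ a, ∑ T with H ⊆ T, D.map (insert a T) (X a * g) = 0 := by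
    rw [Finset.sum_comm]
    exact Finset.sum_eq_zero fun T _ => D.sum_map_insert T g
  rw [← Finset.sum_subset (Finset.subset_univ H)
    fun a _ ha => sum_insert_eq_zero (fun T => D.map T (X a * g)) ha] at h
  rw [Finset.sum_mul, map_sum, ← h]
  refine Finset.sum_congr rfl fun a ha => ?_
  rw [upper_apply]
  refine Finset.sum_congr rfl fun T hT => ?_
  rw [Finset.insert_eq_of_mem ((Finset.mem_filter.1 hT).2 ha)]

/-- The map induced by `upper` on the cohits of the polynomials in one variable less. -/
noncomputable def lower : ((𝔓 (Fin k)) ⧸ cohitKer (Fin k) m) →ₗ[ZMod 2] V :=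
  (cohitKer (Fin k) m).liftQ (D.upper H ∘ₗ (inflate H).toLinearMap)
    fun _ hy => D.upper_eq_zero_of_mem H (inflate_mem H hy)

lemma lower_mkQ (y : 𝔓 (Fin k)) :
    D.lower H ((cohitKer (Fin k) m).mkQ y) = D.upper H (inflate H y) := rfl

variable {H}

lemma upper_eq_lower (hH : H.Nonempty) (y : 𝔓 (Fin (k + 1))) :
    D.upper H y = D.lower H ((cohitKer (Fin k) m).mkQ (collapse H y)) := by
  obtain ⟨g, hg⟩ := exists_eq_inflate_collapse_add hH y
  conv_lhs => rw [hg]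
  rw [map_add, upper_sum_X_mul, add_zero, lower_mkQ]

lemma natCast_two_pow_smul {M : Type*} [AddCommGroup M] [Module (ZMod 2) M] {n : ℕ} (hn : n ≠ 0)
    (x : M) : (2 ^ n) • x = 0 := by
  obtain ⟨n, rfl⟩ := Nat.exists_eq_succ_of_ne_zero hn
  rw [pow_succ, mul_smul, two_nsmul, ZModModule.add_self, smul_zero]

/-- Modulo 2 the number of sets between two sets is one or zero. -/
lemma card_Icc_nsmul {α : Type*} [Fintype α] [DecidableEq α] {M : Type*} [AddCommGroup M]
    [Module (ZMod 2) M] (s t : Finset α) (x : M) :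
    (Finset.univ.filter fun u => s ⊆ u ∧ u ⊆ t).card • x = if s = t then x else 0 := by
  have hI : (Finset.univ.filter fun u => s ⊆ u ∧ u ⊆ t) = Finset.Icc s t := by
    ext u; simp
  rw [hI]
  by_cases hst : s ⊆ t
  · rw [Finset.card_Icc_finset hst]
    split_ifs with h
    · simp [h]
    · have := Finset.card_lt_card (hst.ssubset_of_ne h)
      exact natCast_two_pow_smul (by omega) x
  · rw [if_neg (by rintro rfl; exact hst subset_rfl), Finset.Icc_eq_empty hst, Finset.card_empty,
      zero_smul]

lemma proj_lower (hH : H.Nonempty) {H' : Finset (Fin (k + 1))} (hH' : H'.Nonempty)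
    (v : (𝔓 (Fin k)) ⧸ cohitKer (Fin k) m) :
    D.proj H' (D.lower H v) = if H = H' then v else 0 := by
  obtain ⟨z, rfl⟩ := Submodule.mkQ_surjective _ v
  rw [lower_mkQ, upper_apply, map_sum, Finset.sum_congr rfl fun S hS =>
    D.proj_map H' S hH' (hH.mono (Finset.mem_filter.1 hS).2) _, ← Finset.sum_filter,
    Finset.filter_filter, Finset.sum_const, card_Icc_nsmul]
  split_ifs with h
  · rw [← h, collapse_inflate]
  · rfl

lemma sum_upper (S : Finset (Fin (k + 1))) (y : 𝔓 (Fin (k + 1))) :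
    ∑ H with S ⊆ H, D.upper H y = D.map S y := by
  simp only [upper_apply]
  rw [Finset.sum_comm' (t' := Finset.univ)
    (s' := fun T => Finset.univ.filter fun H => S ⊆ H ∧ H ⊆ T) (by simp)]
  simp [card_Icc_nsmul]

/-- The target of a system of Kameko maps is a direct sum of copies, indexed by the nonempty sets of
variables, of the cohits of the polynomials in one variable less. -/
noncomputable def equiv : ({H : Finset (Fin (k + 1)) // H.Nonempty} →
    (𝔓 (Fin k)) ⧸ cohitKer (Fin k) m) ≃ₗ[ZMod 2] V :=
  LinearEquiv.ofBijective (∑ H : {H : Finset (Fin (k + 1)) // H.Nonempty},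
    D.lower H.1 ∘ₗ LinearMap.proj H) <| by
  classical
  constructor
  · rw [← LinearMap.ker_eq_bot, LinearMap.ker_eq_bot']
    intro v hv
    funext H
    have h := congrArg (D.proj H.1) hv
    rw [LinearMap.sum_apply, map_sum, map_zero, Finset.sum_eq_single H] at h
    · simpa [D.proj_lower H.2 H.2] using h
    · intro H' _ hne
      rw [LinearMap.comp_apply, D.proj_lower H'.2 H.2, if_neg (fun h => hne (Subtype.ext h))]
    · simp
  · rw [← LinearMap.range_eq_top, eq_top_iff, ← D.iSup_range]
    refine iSup_le fun S => ?_
    rintro _ ⟨y, rfl⟩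
    rw [← sum_upper]
    refine Submodule.sum_mem _ fun H hH => ?_
    have hne : H.Nonempty := S.2.mono (Finset.mem_filter.1 hH).2
    rw [D.upper_eq_lower hne]
    refine ⟨Pi.single ⟨H, hne⟩ ((cohitKer (Fin k) m).mkQ (collapse H y)), ?_⟩
    rw [LinearMap.sum_apply, Finset.sum_eq_single ⟨H, hne⟩]
    · rw [LinearMap.comp_apply, LinearMap.proj_apply, Pi.single_eq_same]
    · intro H' _ h
      rw [LinearMap.comp_apply, LinearMap.proj_apply, Pi.single_eq_of_ne h, map_zero]
    · simp

lemma finrank_eq (hfin : 0 < Module.finrank (ZMod 2) ((𝔓 (Fin k)) ⧸ cohitKer (Fin k) m))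
    (D : KamekoSystem k m V) : Module.finrank (ZMod 2) V =
      (2 ^ (k + 1) - 1) * Module.finrank (ZMod 2) ((𝔓 (Fin k)) ⧸ cohitKer (Fin k) m) := by
  have := Module.finite_of_finrank_pos hfin
  rw [← D.equiv.finrank_eq, Module.finrank_pi_fintype, Finset.sum_const, Finset.card_univ,
    smul_eq_mul]
  congr 1
  simp only [Finset.nonempty_iff_ne_empty]
  rw [Fintype.card_subtype_compl, Fintype.card_finset, Fintype.card_fin, Fintype.card_subtype_eq]

end KamekoSystem

end System

section Extension

variable {k m : ℕ} {V : Type*} [AddCommGroup V] [Module (ZMod 2) V]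

local notation "𝔓" σ => MvPolynomial σ (ZMod 2)

/-- The relations of a system of maps for the set of all variables follow from the others. -/
lemma sum_map_insert_univ (D : Finset (Fin (k + 1)) → (𝔓 (Fin (k + 1))) →ₗ[ZMod 2] V)
    (h : ∀ T, T ≠ Finset.univ → ∀ g, ∑ a, D (insert a T) (X a * g) = 0)
    (g : 𝔓 (Fin (k + 1))) : ∑ a, D Finset.univ (X a * g) = 0 := by
  have h1 : ∑ T, ∑ a, D (insert a T) (X a * g) = 0 := by
    rw [Finset.sum_comm]
    refine Finset.sum_eq_zero fun a _ => ?_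
    have := KamekoSystem.sum_insert_eq_zero (fun T => D T (X a * g)) (Finset.notMem_empty a)
    simpa using this
  rw [Finset.sum_eq_single_of_mem Finset.univ (Finset.mem_univ _) fun T _ hT => h T hT g] at h1
  simpa using h1

/-- The sum of all variables but `X j`. -/
noncomputable def sumErase (j : Fin (k + 1)) : 𝔓 (Fin (k + 1)) := ∑ a ∈ Finset.univ.erase j, X a

lemma X_add_sumErase (j : Fin (k + 1)) : X j + sumErase j = (∑ a, X a : 𝔓 (Fin (k + 1))) :=
  Finset.add_sum_erase _ _ (Finset.mem_univ j)

lemma stSq_succ_sumErase_mul (i : ℕ) (j : Fin (k + 1)) (u : 𝔓 (Fin (k + 1))) :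
    stSq _ (i + 1) (sumErase j * u) =
      sumErase j * stSq _ (i + 1) u + sumErase j ^ 2 * stSq _ i u := by
  rw [sumErase, sum_pow_char, Finset.sum_mul, map_sum, Finset.sum_mul, Finset.sum_mul,
    ← Finset.sum_add_distrib]
  exact Finset.sum_congr rfl fun a _ => stSq_succ_X_mul i a u

variable (D : Finset (Fin (k + 1)) → (𝔓 (Fin (k + 1))) →ₗ[ZMod 2] V)

open Classical in
/-- The map for the set of all variables that is forced by the maps for the other sets. -/
noncomputable def topMap : (𝔓 (Fin (k + 1))) →ₗ[ZMod 2] V :=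
  (basisMonomials (Fin (k + 1)) (ZMod 2)).constr (ZMod 2) fun e =>
    if h : ∃ j, e j ≠ 0 then D (Finset.univ.erase h.choose)
      (sumErase h.choose * monomial (e - Finsupp.single h.choose 1) 1) else 0

lemma topMap_monomial (e : Fin (k + 1) →₀ ℕ) [Decidable (∃ j, e j ≠ 0)] :
    topMap D (monomial e 1) = if h : ∃ j, e j ≠ 0 then D (Finset.univ.erase h.choose)
      (sumErase h.choose * monomial (e - Finsupp.single h.choose 1) 1) else 0 := by
  have := (basisMonomials (Fin (k + 1)) (ZMod 2)).constr_basis (ZMod 2)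
    (fun e => open Classical in if h : ∃ j, e j ≠ 0 then D (Finset.univ.erase h.choose)
      (sumErase h.choose * monomial (e - Finsupp.single h.choose 1) 1) else 0) e
  rw [coe_basisMonomials] at this
  rw [topMap, this]
  congr

lemma topMap_one : topMap D 1 = 0 := by
  classical
  have := topMap_monomial D 0
  rwa [dif_neg (by simp)] at this

variable {D}
variable (ha : ∀ T : Finset (Fin (k + 1)), T.card + 1 ≤ k → ∀ g, ∑ a, D (insert a T) (X a * g) = 0)
  (hb : ∀ S, ∀ y ∈ cohitKer (Fin (k + 1)) m, D S y = 0)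

include ha hb in
lemma sum_insert_X_sq_mul {T : Finset (Fin (k + 1))} (hT : T.card + 1 ≤ k)
    (g : 𝔓 (Fin (k + 1))) : ∑ a, D (insert a T) (X a ^ 2 * g) = 0 := by
  have h : ∀ a, D (insert a T) (X a ^ 2 * g) = D (insert a T) (X a * stSq _ 1 g) := fun a => by
    have := hb (insert a T) _ (stSq_mem_cohitKer m one_pos (X a * g))
    rw [stSq_one_mul, stSq_X, map_add] at this
    rw [← sub_eq_zero, ZModModule.sub_eq_add, add_comm]
    simpa using this
  rw [Finset.sum_congr rfl fun a _ => h a]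
  exact ha T hT _

include ha hb in
lemma map_erase_consistent {i j : Fin (k + 1)} (hij : i ≠ j) (g : 𝔓 (Fin (k + 1))) :
    D (Finset.univ.erase j) (sumErase j * (X i * g)) =
      D (Finset.univ.erase i) (sumErase i * (X j * g)) := by
  set T := (Finset.univ.erase i).erase j with hT
  have hjm : j ∈ Finset.univ.erase i := by simp [hij.symm]
  have hc : T.card + 1 ≤ k := by
    rw [hT, Finset.card_erase_of_mem hjm, Finset.card_erase_of_mem (Finset.mem_univ i),
      Finset.card_univ, Fintype.card_fin]
    have := Finset.card_pos.2 ⟨j, hjm⟩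
    rw [Finset.card_erase_of_mem (Finset.mem_univ i), Finset.card_univ, Fintype.card_fin] at this
    omega
  have hi : insert i T = Finset.univ.erase j := by
    rw [hT, Finset.erase_right_comm]; exact Finset.insert_erase (by simp [hij])
  have hj : insert j T = Finset.univ.erase i := Finset.insert_erase hjm
  have split : ∀ f : Fin (k + 1) → 𝔓 (Fin (k + 1)), ∑ a, D (insert a T) (f a) =
      D (Finset.univ.erase j) (f i) + D (Finset.univ.erase i) (f j) + D T (∑ a ∈ T, f a) := by
    intro f
    rw [sum_eq_add_add_sum_erase _ hij, hi, hj, map_sum]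
    exact congrArg _ (Finset.sum_congr rfl fun a h => by rw [Finset.insert_eq_of_mem h])
  have h1 := ha T hc ((∑ a ∈ T, X a) * g)
  have h2 := sum_insert_X_sq_mul ha hb hc g
  rw [split, ← Finset.sum_mul] at h1 h2
  rw [← mul_assoc (∑ a ∈ T, X a), ← sq] at h1
  rw [← sum_pow_char] at h2
  have hsi : sumErase i = X j + (∑ a ∈ T, X a : 𝔓 (Fin (k + 1))) :=
    (Finset.add_sum_erase _ _ hjm).symm
  have hsj : sumErase j = X i + (∑ a ∈ T, X a : 𝔓 (Fin (k + 1))) := by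
    rw [hT, Finset.erase_right_comm]
    exact (Finset.add_sum_erase _ _ (by simp [hij])).symm
  have hexp : ∀ x z : 𝔓 (Fin (k + 1)), (x + z) * (x * g) = x ^ 2 * g + x * (z * g) :=
    fun x z => by ring
  rw [hsi, hsj, hexp, hexp, map_add, map_add]
  have e1 := ZModModule.add_self (D T ((∑ a ∈ T, X a) ^ 2 * g))
  have e2 := ZModModule.add_self (D (Finset.univ.erase i) (X j ^ 2 * g))
  have e3 := ZModModule.add_self (D (Finset.univ.erase i) (X j * ((∑ a ∈ T, X a) * g)))
  linear_combination (norm := abel) h1 + h2 - e1 - e2 - e3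

include ha hb in
lemma topMap_X_mul (j : Fin (k + 1)) (g : 𝔓 (Fin (k + 1))) :
    topMap D (X j * g) = D (Finset.univ.erase j) (sumErase j * g) := by
  classical
  suffices h : ∀ e, topMap D (X j * monomial e 1) =
      D (Finset.univ.erase j) (sumErase j * monomial e 1) by
    have := MvPolynomial.linearMap_eq_of_monomial
      (A := topMap D ∘ₗ LinearMap.mulLeft (ZMod 2) (X j))
      (B := D (Finset.univ.erase j) ∘ₗ LinearMap.mulLeft (ZMod 2) (sumErase j))
      (fun e => by simpa only [LinearMap.comp_apply, LinearMap.mulLeft_apply] using h e) g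
    simpa only [LinearMap.comp_apply, LinearMap.mulLeft_apply] using this
  intro e
  have h : ∃ i, (e + Finsupp.single j 1 : Fin (k + 1) →₀ ℕ) i ≠ 0 := ⟨j, by simp⟩
  rw [← monomial_add_single_one, topMap_monomial, dif_pos h]
  have hi := h.choose_spec
  set i := h.choose
  by_cases hij : i = j
  · rw [hij, add_tsub_cancel_right]
  · have hle : Finsupp.single i 1 ≤ e := by
      rw [Finsupp.single_le_iff, Nat.one_le_iff_ne_zero]
      simpa [Finsupp.single_apply, Ne.symm hij] using hi
    have he : e + Finsupp.single j 1 - Finsupp.single i 1 =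
        e - Finsupp.single i 1 + Finsupp.single j 1 := tsub_add_eq_add_tsub hle |>.symm
    rw [he, monomial_add_single_one]
    conv_rhs => rw [← tsub_add_cancel_of_le hle, monomial_add_single_one]
    exact (map_erase_consistent ha hb hij _).symm

variable (D) in
/-- The system of maps completed by `topMap`. -/
noncomputable def completeMap (S : Finset (Fin (k + 1))) : (𝔓 (Fin (k + 1))) →ₗ[ZMod 2] V :=
  if S = Finset.univ then topMap D else D S

lemma completeMap_univ : completeMap D Finset.univ = topMap D := if_pos rfl

lemma completeMap_of_ne {S : Finset (Fin (k + 1))} (hS : S ≠ Finset.univ) :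
    completeMap D S = D S := if_neg hS

include ha hb in
lemma sum_completeMap_insert_of_ne {T : Finset (Fin (k + 1))} (hT : T ≠ Finset.univ)
    (g : 𝔓 (Fin (k + 1))) : ∑ a, completeMap D (insert a T) (X a * g) = 0 := by
  by_cases hc : T.card + 1 ≤ k
  · rw [← ha T hc g]
    refine Finset.sum_congr rfl fun a _ => ?_
    rw [completeMap_of_ne]
    intro h
    have := Finset.card_insert_le a T
    rw [h, Finset.card_univ, Fintype.card_fin] at this
    omega
  · obtain ⟨j, hj⟩ : ∃ j, j ∉ T := by
      by_contra! h
      exact hT (Finset.eq_univ_iff_forall.2 h)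
    have hT' : T = Finset.univ.erase j := Finset.eq_of_subset_of_card_le
      (fun x hx => by simp; rintro rfl; exact hj hx) (by
        rw [Finset.card_erase_of_mem (Finset.mem_univ j), Finset.card_univ, Fintype.card_fin]
        omega)
    rw [← Finset.add_sum_erase _ _ (Finset.mem_univ j), hT',
      Finset.insert_erase (Finset.mem_univ j), completeMap_univ, topMap_X_mul ha hb,
      Finset.sum_congr rfl fun a h => by rw [Finset.insert_eq_of_mem h, completeMap_of_ne (by simp)],
      ← map_sum, ← Finset.sum_mul, sumErase, ZModModule.add_self]

include ha hb in
lemma sum_completeMap_insert (T : Finset (Fin (k + 1))) (g : 𝔓 (Fin (k + 1))) :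
    ∑ a, completeMap D (insert a T) (X a * g) = 0 := by
  by_cases hT : T = Finset.univ
  · subst hT
    simpa using sum_map_insert_univ (completeMap D)
      (fun T hT => sum_completeMap_insert_of_ne ha hb hT) g
  · exact sum_completeMap_insert_of_ne ha hb hT g

include ha hb in
lemma topMap_eq_zero_of_mem {y : 𝔓 (Fin (k + 1))} (hy : y ∈ cohitKer _ m) : topMap D y = 0 := by
  refine cohitKer_le (p := LinearMap.ker (topMap D)) (fun i e hi => ?_) (fun e he => ?_) hy
  · rw [LinearMap.mem_ker]
    induction e using Finsupp.induction_add_single_one with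
    | zero =>
      change topMap D (stSq _ i 1) = 0
      rw [stSq_one_eq_zero hi, map_zero]
    | add_single e j _ =>
      obtain ⟨i, rfl⟩ := Nat.exists_eq_succ_of_ne_zero hi.ne'
      set u : 𝔓 (Fin (k + 1)) := monomial e 1
      have h1 := hb (Finset.univ.erase j) _ (stSq_mem_cohitKer m i.succ_pos (sumErase j * u))
      have h2 := sum_completeMap_insert ha hb Finset.univ (X j * stSq _ i u)
      simp only [Finset.insert_eq_of_mem (Finset.mem_univ _), completeMap_univ] at h2
      rw [← map_sum, ← Finset.sum_mul, ← X_add_sumErase j, mul_left_comm, topMap_X_mul ha hb,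
        add_mul, mul_add, map_add] at h2
      rw [stSq_succ_sumErase_mul, map_add] at h1
      rw [monomial_add_single_one, Nat.succ_eq_add_one, stSq_succ_X_mul, sq, mul_assoc, map_add,
        topMap_X_mul ha hb, topMap_X_mul ha hb]
      rw [← h1, ← ZModModule.sub_eq_add, ← ZModModule.sub_eq_add, sub_right_inj, ← sub_eq_zero,
        ZModModule.sub_eq_add, ← h2, sq, mul_assoc]
  · rw [LinearMap.mem_ker]
    induction e using Finsupp.induction_add_single_one with
    | zero => exact topMap_one D
    | add_single e j _ =>
      rw [monomial_add_single_one, topMap_X_mul ha hb]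
      refine hb _ _ (mem_cohitKer_of_isHomogeneous (d := 1 + e.degree) ?_ ?_)
      · exact (IsHomogeneous.sum _ _ _ fun a _ => isHomogeneous_X _ a).mul
          (isHomogeneous_monomial 1 rfl)
      · rwa [map_add, Finsupp.degree_single, add_comm] at he

end Extension

section Construction

variable {k m : ℕ}

local notation "𝔓" σ => MvPolynomial σ (ZMod 2)

/-- The detecting projections of the Kameko maps. -/
noncomputable def detect (k m d : ℕ) (H : Finset (Fin (k + 1))) :
    ((𝔓 (Fin (k + 1))) ⧸ cohitKer (Fin (k + 1)) (lev k m d)) →ₗ[ZMod 2]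
      (𝔓 (Fin k)) ⧸ cohitKer (Fin k) m :=
  Submodule.mapQ _ _ ((downKameko (Fin k) ^ d) ∘ₗ (collapse H).toLinearMap)
    fun _ hf => downKameko_iterate_mem (Fintype.card_fin k) d (collapse_mem H hf)

variable (hL : ∀ j, IsLow (Fin (k + 1)) (lev k m (j + 1)))

include hL in
lemma detect_kamekoSet {d : ℕ} {H S : Finset (Fin (k + 1))} (hH : H.Nonempty) (hS : S.Nonempty)
    (hd : S.card ≤ d) (y : 𝔓 (Fin (k + 1))) : detect k m d H (kamekoSet k m d S y) =
      if S ⊆ H then (cohitKer (Fin k) m).mkQ (collapse H y) else 0 := by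
  obtain ⟨l, rfl, rfl⟩ := List.exists_toFinset_eq S hS hd
  rw [kamekoSet_toFinset (Fintype.card_fin _) hL l rfl]
  change (cohitKer (Fin k) m).mkQ ((downKameko (Fin k) ^ l.length) (collapse H (kameko l y))) = _
  rw [downKameko_collapse_kameko hH, apply_ite (cohitKer (Fin k) m).mkQ, map_zero]

/-- The system of Kameko maps in the case of at least as many squarings as variables. -/
noncomputable def kamekoSystemOfLe {d : ℕ} (hd : k ≤ d) :
    KamekoSystem k m ((𝔓 (Fin (k + 1))) ⧸ cohitKer (Fin (k + 1)) (lev k m (d + 1))) :=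
  have hT : ∀ T : Finset (Fin (k + 1)), T ≠ Finset.univ → ∀ g,
      ∑ a, kamekoSet k m (d + 1) (insert a T) (X a * g) = 0 := fun T hT =>
    sum_kamekoSet_insert (Fintype.card_fin _) hL d (by
      have := Finset.card_lt_card (Finset.ssubset_univ_iff.2 hT)
      rw [Finset.card_univ, Fintype.card_fin] at this
      omega)
  { map := kamekoSet k m (d + 1)
    proj := detect k m (d + 1)
    sum_map_insert := fun T g => by
      by_cases h : T = Finset.univ
      · subst h
        simpa using sum_map_insert_univ _ hT g
      · exact hT T h g
    map_eq_zero := fun S y hy => kamekoSet_eq_zero_of_mem (Fintype.card_fin _) hL _ S hy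
    proj_map := fun H S hH hS => detect_kamekoSet hL hH hS (by
      have := Finset.card_le_univ S
      rw [Fintype.card_fin] at this
      omega)
    iSup_range := iSup_range_kamekoSet (Fintype.card_fin _) hL d }

include hL in
lemma detect_topMap (hm : m ≠ 0) {d : ℕ} (hk : k = d + 1) {H : Finset (Fin (k + 1))}
    (hH : H.Nonempty) (y : 𝔓 (Fin (k + 1))) :
    detect k m (d + 1) H (topMap (kamekoSet k m (d + 1)) y) =
      if Finset.univ ⊆ H then (cohitKer (Fin k) m).mkQ (collapse H y) else 0 := by
  suffices h : ∀ e, detect k m (d + 1) H (topMap (kamekoSet k m (d + 1)) (monomial e 1)) =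
      if Finset.univ ⊆ H then (cohitKer (Fin k) m).mkQ (collapse H (monomial e 1)) else 0 by
    have := MvPolynomial.linearMap_eq_of_monomial
      (A := detect k m (d + 1) H ∘ₗ topMap (kamekoSet k m (d + 1)))
      (B := if Finset.univ ⊆ H then (cohitKer (Fin k) m).mkQ ∘ₗ (collapse H).toLinearMap else 0)
      (fun e => by rw [LinearMap.comp_apply, h]; split_ifs <;> rfl) y
    rw [LinearMap.comp_apply] at this
    rw [this]
    split_ifs <;> rfl
  intro e
  induction e using Finsupp.induction_add_single_one with
  | zero =>
    have h1 : (1 : 𝔓 (Fin k)) ∈ cohitKer (Fin k) m :=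
      monomial_mem_cohitKer (e := 0) (by simpa using hm.symm)
    have h2 : (monomial 0 1 : 𝔓 (Fin (k + 1))) = 1 := rfl
    rw [h2, topMap_one, map_zero, map_one, Submodule.mkQ_apply,
      (Submodule.Quotient.mk_eq_zero _).2 h1, ite_self]
  | add_single e j _ =>
    have hc : (Finset.univ.erase j).card = k := by simp
    rw [monomial_add_single_one, topMap_X_mul (m := m)
      (fun T hT => sum_kamekoSet_insert (Fintype.card_fin _) hL d (by omega))
      (fun S y hy => kamekoSet_eq_zero_of_mem (Fintype.card_fin _) hL _ S hy),
      detect_kamekoSet hL hH (Finset.card_pos.1 (by omega)) (by omega),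
      map_mul (collapse H), map_mul (collapse H)]
    by_cases h : Finset.univ ⊆ H
    · obtain rfl := Finset.univ_subset_iff.1 h
      have := congrArg (collapse Finset.univ) (X_add_sumErase j)
      rw [collapse_sum_X hH, map_add, CharTwo.add_eq_zero] at this
      rw [if_pos (Finset.erase_subset _ _), if_pos h, this]
    · rw [if_neg h, ite_eq_right_iff]
      intro hs
      have hH' : H = Finset.univ.erase j := by
        refine (Finset.eq_of_subset_of_card_le hs ?_).symm
        have := Finset.card_lt_card (Finset.ssubset_univ_iff.2 fun h' => h h'.ge)
        rw [Finset.card_univ, Fintype.card_fin] at this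
        omega
      rw [sumErase, ← hH', collapse_sum_X hH, zero_mul, map_zero]

/-- The system of Kameko maps in the case of one squaring less than the number of variables. -/
noncomputable def kamekoSystemOfEq (hm : m ≠ 0) {d : ℕ} (hk : k = d + 1) :
    KamekoSystem k m ((𝔓 (Fin (k + 1))) ⧸ cohitKer (Fin (k + 1)) (lev k m (d + 1))) :=
  have ha : ∀ T : Finset (Fin (k + 1)), T.card + 1 ≤ k → ∀ g,
      ∑ a, kamekoSet k m (d + 1) (insert a T) (X a * g) = 0 := fun T hT =>
    sum_kamekoSet_insert (Fintype.card_fin _) hL d (by omega)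
  have hb : ∀ S, ∀ y ∈ cohitKer (Fin (k + 1)) m, kamekoSet k m (d + 1) S y = 0 := fun S y hy =>
    kamekoSet_eq_zero_of_mem (Fintype.card_fin _) hL _ S hy
  { map := completeMap (kamekoSet k m (d + 1))
    proj := detect k m (d + 1)
    sum_map_insert := sum_completeMap_insert ha hb
    map_eq_zero := fun S y hy => by
      rw [completeMap]
      split_ifs
      · exact topMap_eq_zero_of_mem ha hb hy
      · exact hb S y hy
    proj_map := fun H S hH hS y => by
      by_cases h : S = Finset.univ
      · rw [h, completeMap_univ, detect_topMap hL hm hk hH]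
      · rw [completeMap_of_ne h]
        refine detect_kamekoSet hL hH hS ?_ y
        have := Finset.card_lt_card (Finset.ssubset_univ_iff.2 h)
        rw [Finset.card_univ, Fintype.card_fin] at this
        omega
    iSup_range := by
      rw [eq_top_iff, ← iSup_range_kamekoSet (Fintype.card_fin _) hL d]
      refine iSup_mono fun S => ?_
      by_cases h : S.1 = Finset.univ
      · rintro _ ⟨y, rfl⟩
        rw [h, kamekoSet, dif_neg]
        · exact Submodule.zero_mem _
        · rintro ⟨l, hl, hl'⟩
          have := l.toFinset_card_le
          rw [hl', hl, Finset.card_univ, Fintype.card_fin] at this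
          omega
      · rw [completeMap_of_ne h] }

end Construction

section Main

local notation "𝔓" σ => MvPolynomial σ (ZMod 2)

lemma lev_eq_sum {k : ℕ} (hk : 1 ≤ k) (f : ℕ → ℕ) (hf : f k = 0) (j : ℕ) :
    lev k (∑ i ∈ Finset.Icc 1 (k - 1), (2 ^ f i - 1)) j =
      ∑ i ∈ Finset.Icc 1 k, (2 ^ (f i + j) - 1) := by
  induction j with
  | zero =>
    obtain ⟨k, rfl⟩ := Nat.exists_eq_add_of_le' hk
    rw [Finset.sum_Icc_succ_top (by omega), hf]
    rfl
  | succ j ih =>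
    rw [lev, ih, Finset.mul_sum]
    conv_lhs => enter [1]; rw [← Nat.add_sub_cancel k 1, ← Nat.card_Icc, Finset.card_eq_sum_ones]
    rw [← Finset.sum_add_distrib]
    refine Finset.sum_congr rfl fun i _ => ?_
    have := Nat.one_le_two_pow (n := f i + j)
    rw [← add_assoc, pow_succ]
    omega

lemma finrank_cohit_eq_prod {k : ℕ} (d : ℕ → ℕ) (h12 : 1 ≤ k → d 2 + 2 ≤ d 1)
    (hgap : ∀ i, 3 ≤ i → i ≤ k → d i + (i - 1) ≤ d (i - 1)) (hlast : 1 ≤ k → k ≤ d k) :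
    Module.finrank (ZMod 2)
      ((𝔓 (Fin (k + 1))) ⧸ cohitKer (Fin (k + 1)) (∑ i ∈ Finset.Icc 1 k, (2 ^ d i - 1))) =
      ∏ i ∈ Finset.Icc 1 (k + 1), (2 ^ i - 1) := by
  induction k generalizing d with
  | zero => exact ((finrank_QP 1 0).symm.trans (finrank_QP_zero 1)).trans (by simp)
  | succ k ih =>
    set K := k + 1 with hK
    have h12 : d 2 + 2 ≤ d 1 := h12 (by omega)
    have hlast := hlast (by omega)
    have hstep : ∀ i, 1 ≤ i → i + 1 ≤ K → d (i + 1) < d i := fun i h1 h2 => by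
      obtain rfl | h3 : i = 1 ∨ 2 ≤ i := by omega
      · change d 2 < d 1
        omega
      · have := hgap (i + 1) (by omega) h2
        rw [Nat.add_sub_cancel] at this
        omega
    have hanti : ∀ i j, 1 ≤ i → i < j → j ≤ K → d j < d i := fun i j h1 hij hj => by
      induction j, hij using Nat.le_induction with
      | base => exact hstep i h1 hj
      | succ j hij ih => exact (hstep j (by omega) hj).trans (ih (by omega))
    have hle : ∀ i ∈ Finset.Icc 1 K, d K ≤ d i := fun i hi => by
      rw [Finset.mem_Icc] at hi
      obtain rfl | h := hi.2.eq_or_lt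
      · exact le_rfl
      · exact (hanti i K hi.1 h le_rfl).le
    set f : ℕ → ℕ := fun i => d i - d K with hf
    set m := ∑ i ∈ Finset.Icc 1 k, (2 ^ f i - 1)
    have hlev : ∀ j, lev K m j = ∑ i ∈ Finset.Icc 1 K, (2 ^ (f i + j) - 1) :=
      lev_eq_sum (by omega) f (by simp [hf])
    have hL : ∀ j, IsLow (Fin (K + 1)) (lev K m (j + 1)) := fun j =>
      isLow_of_eq_sum (Fintype.card_fin _) (Finset.Icc 1 K) (by simp) (fun i => f i + (j + 1))
        (fun a ha b hb hab => by
          have h1 := hle a ha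
          have h2 := hle b hb
          rw [Finset.mem_coe, Finset.mem_Icc] at ha hb
          have h3 := hanti a b ha.1
          have h4 := hanti b a hb.1
          simp only [hf] at hab
          omega)
        (fun i _ => by omega) (hlev (j + 1))
    have htarget : ∑ i ∈ Finset.Icc 1 K, (2 ^ d i - 1) = lev K m (d K) := by
      rw [hlev]
      refine Finset.sum_congr rfl fun i hi => ?_
      rw [hf, Nat.sub_add_cancel (hle i hi)]
    have hdrop : ∀ i, 1 ≤ i → i ≤ K → d K ≤ d i := fun i h1 h2 => hle i (Finset.mem_Icc.2 ⟨h1, h2⟩)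
    have hIH : Module.finrank (ZMod 2) ((𝔓 (Fin K)) ⧸ cohitKer (Fin K) m) =
        ∏ i ∈ Finset.Icc 1 K, (2 ^ i - 1) := by
      refine ih f (fun h => ?_) (fun i h3 hi => ?_) fun h => ?_
      · have := hdrop 2 (by omega) (by omega)
        simp only [hf]
        omega
      · have := hdrop i (by omega) (by omega)
        have := hgap i h3 (by omega)
        simp only [hf]
        omega
      · obtain rfl | h2 : k = 1 ∨ 2 ≤ k := by omega
        · change 1 ≤ d 1 - d 2
          omega
        · have := hgap K (by omega) le_rfl
          rw [hK, Nat.add_sub_cancel] at this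
          simp only [hf, hK]
          omega
    have hpos : 0 < Module.finrank (ZMod 2) ((𝔓 (Fin K)) ⧸ cohitKer (Fin K) m) := by
      rw [hIH]
      refine Finset.prod_pos fun i hi => ?_
      rw [Finset.mem_Icc] at hi
      have := Nat.one_lt_two_pow (n := i) (by omega)
      omega
    obtain ⟨D, hD⟩ : ∃ D, d K = D + 1 := Nat.exists_eq_succ_of_ne_zero (by omega)
    rw [htarget, hD, Finset.prod_Icc_succ_top (by omega), mul_comm, ← hIH]
    by_cases hKD : K ≤ D
    · exact (kamekoSystemOfLe hL hKD).finrank_eq hpos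
    · refine (kamekoSystemOfEq hL (fun h0 => ?_) (d := D) (by omega)).finrank_eq hpos
      obtain rfl | hk : k = 0 ∨ 1 ≤ k := by omega
      · change d 1 = D + 1 at hD
        omega
      · have h1 := Finset.sum_eq_zero_iff.1 h0 1 (Finset.mem_Icc.2 ⟨le_rfl, hk⟩)
        have h2 := hanti 1 K le_rfl (by omega) le_rfl
        have := Nat.one_lt_two_pow (n := f 1) (by simp only [hf]; omega)
        omega

end Main

/-- Corollary 1.5: for `k ≥ 3` and positive integers `d_1, …, d_{k-1}` with
`d_1 - d_2 ≥ 2`, `d_{i-1} - d_i ≥ i - 1` for `3 ≤ i ≤ k - 1`, and `d_{k-1} ≥ k - 1`,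
setting `n = Σ_{i=1}^{k-1} (2^{d_i} - 1)`, one has
`dim (QP_k)_n = Π_{i=1}^{k} (2^i - 1)`. -/
theorem stmt6 (k : ℕ) (hk : 3 ≤ k) (d : ℕ → ℕ)
    (hpos : ∀ i, 1 ≤ i → i ≤ k - 1 → 0 < d i)
    (h12 : d 2 + 2 ≤ d 1)
    (hgap : ∀ i, 3 ≤ i → i ≤ k - 1 → d i + (i - 1) ≤ d (i - 1))
    (hlast : k - 1 ≤ d (k - 1)) :
    Module.finrank (ZMod 2) (QP k (∑ i ∈ Finset.Icc 1 (k - 1), (2 ^ d i - 1))) =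
      ∏ i ∈ Finset.Icc 1 k, (2 ^ i - 1) := by
  obtain ⟨k, rfl⟩ := Nat.exists_eq_add_of_le' (show 1 ≤ k by omega)
  rw [finrank_QP]
  exact finrank_cohit_eq_prod d (fun _ => h12) hgap fun _ => hlast
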